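/- arXiv:math/0601175 — 2 statements merged into one kernel-verified Lean document; each statement's English description precedes it below -/
import Mathlib

section
/- Let A be a semilocal UFD with quotient field F, π ∈ A[t] monic irreducible, B = A[t]/(π), L = Q(B). Then for every monic irreducible π' ∈ F[t] with π' ∉ A[t], the composition K^t_n(A) → K^M_n(F(t)) → K^M_{n-1}(F[t]/(π')) (natural map followed by the tame symbol at π') is zero. -/
open Polynomial

/-- Milnor K-theory in degree `n` of a (semilocal) commutative ring `R`: the free
abelian group on `n`-tuples of units modulo multilinearity and the relations
`{…, f, 1-f, …} = 0` and `{…, f, -f, …} = 0` in adjacent slots. -/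
def MilnorRel (R : Type*) [CommRing R] (n : ℕ) :
    AddSubgroup (FreeAbelianGroup (Fin n → Rˣ)) :=
  AddSubgroup.closure
    ({x | ∃ (f : Fin n → Rˣ) (i : Fin n) (a b : Rˣ), f i = a * b ∧
        x = FreeAbelianGroup.of f - FreeAbelianGroup.of (Function.update f i a)
          - FreeAbelianGroup.of (Function.update f i b)} ∪
     {x | ∃ (f : Fin n → Rˣ) (i j : Fin n), (i : ℕ) + 1 = (j : ℕ) ∧
        (((f i : R) + (f j : R) = 1) ∨ ((f i : R) + (f j : R) = 0)) ∧
        x = FreeAbelianGroup.of f})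

def MilnorK (R : Type*) [CommRing R] (n : ℕ) :=
  FreeAbelianGroup (Fin n → Rˣ) ⧸ MilnorRel R n

instance (R : Type*) [CommRing R] (n : ℕ) : AddCommGroup (MilnorK R n) :=
  QuotientAddGroup.Quotient.addCommGroup _

/-- The symbol `{f_1, …, f_n}`. -/
def MilnorSymbol {R : Type*} [CommRing R] {n : ℕ} (f : Fin n → Rˣ) : MilnorK R n :=
  QuotientAddGroup.mk (FreeAbelianGroup.of f)

/-- A tuple of polynomials is feasible if all entries have unit (invertible)
leading coefficients and any two irreducible factors of entries with distinct
indices are equivalent (associated) or coprime. -/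
def Feasible (A : Type*) [CommRing A] {n : ℕ} (p : Fin n → A[X]) : Prop :=
  (∀ i, IsUnit (p i).leadingCoeff) ∧
  ∀ i j, i ≠ j → ∀ u v : A[X], Irreducible u → Irreducible v →
    u ∣ p i → v ∣ p j → Associated u v ∨ IsRelPrime u v

def FeasTuple (A : Type*) [CommRing A] (n : ℕ) := {p : Fin n → A[X] // Feasible A p}

/-- The multilinear expansion in the free abelian group on feasible tuples of the
tuple of rational functions `(p 1/q 1, …, p n/q n)`: the alternating sum over all
ways of choosing numerator or denominator in each slot. -/
def ratClass (A : Type*) [CommRing A] {n : ℕ} (p q : Fin n → A[X])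
    (h : ∀ s : Fin n → Bool, Feasible A fun i => if s i then q i else p i) :
    FreeAbelianGroup (FeasTuple A n) :=
  ∑ s : Fin n → Bool,
    ((-1 : ℤ) ^ (Finset.univ.filter fun i => s i).card) •
      FreeAbelianGroup.of (⟨fun i => if s i then q i else p i, h s⟩ : FeasTuple A n)

/-- The relations defining `K^t_n(A)`: multilinearity of feasible tuples, and the
Steinberg relations for feasible tuples of rational functions `p i/q i` having a
pair of adjacent entries of the form `(r, 1-r)` or `(r, -r)`. -/
def KtRel (A : Type*) [CommRing A] (n : ℕ) :
    AddSubgroup (FreeAbelianGroup (FeasTuple A n)) :=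
  AddSubgroup.closure
    ({x | ∃ (p pa pb : FeasTuple A n) (i : Fin n) (a b : A[X]),
        p.1 i = a * b ∧ pa.1 = Function.update p.1 i a ∧ pb.1 = Function.update p.1 i b ∧
        x = FreeAbelianGroup.of p - FreeAbelianGroup.of pa - FreeAbelianGroup.of pb} ∪
     {x | ∃ (p q : Fin n → A[X])
        (h : ∀ s : Fin n → Bool, Feasible A fun i => if s i then q i else p i)
        (i j : Fin n), (i : ℕ) + 1 = (j : ℕ) ∧
        (p j * q i = (q i - p i) * q j ∨ p j * q i = -(p i) * q j) ∧
        x = ratClass A p q h})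

/-- `K^t_n(A)`, the Milnor-type K-group of feasible tuples over `A[t]`. -/
def Kt (A : Type*) [CommRing A] (n : ℕ) :=
  FreeAbelianGroup (FeasTuple A n) ⧸ KtRel A n

instance (A : Type*) [CommRing A] (n : ℕ) : AddCommGroup (Kt A n) :=
  QuotientAddGroup.Quotient.addCommGroup _

def KtSymbol {A : Type*} [CommRing A] {n : ℕ} (p : FeasTuple A n) : Kt A n :=
  QuotientAddGroup.mk (FreeAbelianGroup.of p)

/-- `D : K^t_{n+1}(A) → K^M_n(A[t]/(π))` is a tame symbol at the monic irreducible
`π ∈ A[t]`: it sends `{π, x_1, …, x_n}` to `{x̄_1, …, x̄_n}` for `x_i ∈ A[t]`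
coprime to `π` (relation (3) of the paper). -/
def IsKtTame (A : Type*) [CommRing A] (n : ℕ) (π : A[X])
    (D : Kt A (n + 1) →+ MilnorK (A[X] ⧸ Ideal.span {π}) n) : Prop :=
  ∀ x : Fin n → A[X], (∀ i, IsRelPrime (x i) π) →
    ∀ (h : Feasible A (Fin.cons π x)) (v : Fin n → (A[X] ⧸ Ideal.span {π})ˣ),
      (∀ i, (v i : A[X] ⧸ Ideal.span {π}) = Ideal.Quotient.mk (Ideal.span {π}) (x i)) →
      D (KtSymbol ⟨Fin.cons π x, h⟩) = MilnorSymbol v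

/-- Tame symbol at a monic irreducible `π' ∈ F[t]` on Milnor K-theory of `F(t)`
(field case), characterized as in Milnor/Bass–Tate. -/
def IsTameSymbol (F : Type*) [Field F] (n : ℕ) (π : F[X])
    (D : MilnorK (RatFunc F) (n + 1) →+ MilnorK (F[X] ⧸ Ideal.span {π}) n) : Prop :=
  (∀ x : Fin n → F[X], (∀ i, IsCoprime (x i) π) →
    ∀ (u : Fin (n + 1) → (RatFunc F)ˣ) (v : Fin n → (F[X] ⧸ Ideal.span {π})ˣ),
      (u 0 : RatFunc F) = algebraMap F[X] (RatFunc F) π →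
      (∀ i : Fin n, (u i.succ : RatFunc F) = algebraMap F[X] (RatFunc F) (x i)) →
      (∀ i, (v i : F[X] ⧸ Ideal.span {π}) = Ideal.Quotient.mk (Ideal.span {π}) (x i)) →
      D (MilnorSymbol u) = MilnorSymbol v) ∧
  (∀ x : Fin (n + 1) → F[X], (∀ i, IsCoprime (x i) π) →
    ∀ u : Fin (n + 1) → (RatFunc F)ˣ,
      (∀ i, (u i : RatFunc F) = algebraMap F[X] (RatFunc F) (x i)) →
      D (MilnorSymbol u) = 0)

/-- A monic irreducible polynomial over the fraction field that is not defined over the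
integrally closed domain `A` is coprime to every polynomial over `A` with unit leading
coefficient. -/
theorem isCoprime_map_of_isUnit_leadingCoeff {A F : Type*} [CommRing A] [IsDomain A]
    [IsIntegrallyClosed A] [Field F] [Algebra A F] [IsFractionRing A F]
    {f : A[X]} (hf : IsUnit f.leadingCoeff) {g : F[X]} (hg : g.Monic) (hirr : Irreducible g)
    (hnot : ¬ ∃ q : A[X], q.map (algebraMap A F) = g) :
    IsCoprime (f.map (algebraMap A F)) g := by
  refine ((hirr.coprime_iff_not_dvd).2 fun hdvd => hnot ?_).symm
  have hmonic : (C (↑hf.unit⁻¹ : A) * f).Monic := by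
    refine monic_C_mul_of_mul_leadingCoeff_eq_one ?_
    exact hf.val_inv_mul
  have hdvd' : g ∣ (C (↑hf.unit⁻¹ : A) * f).map (algebraMap A F) := by
    rw [Polynomial.map_mul]
    exact hdvd.mul_left _
  obtain ⟨q, hq⟩ := IsIntegrallyClosed.eq_map_mul_C_of_dvd F hmonic hdvd'
  exact ⟨q, by simpa [hg.leadingCoeff] using hq⟩

/-- let `A` be a semilocal UFD with fraction field `F`, `π ∈ A[t]`
monic irreducible (with `B = A[t]/(π)`, `L = Q(B)`).  For every monic irreducible
`π' ∈ F[t]` which does not come from `A[t]`, the composite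
`K^t_{n+1}(A) → K^M_{n+1}(F(t)) → K^M_n(F[t]/(π'))` of the natural map with the
tame symbol at `π'` vanishes. -/
theorem kt_to_tame_symbol_outside_A_vanishes (A : Type*) [CommRing A] [IsDomain A]
    [UniqueFactorizationMonoid A]
    (hsemilocal : {I : Ideal A | I.IsMaximal}.Finite)
    (n : ℕ)
    (π : A[X]) (hπmonic : π.Monic) (hπirr : Irreducible π)
    (N : Kt A (n + 1) →+ MilnorK (RatFunc (FractionRing A)) (n + 1))
    (hN : ∀ (p : FeasTuple A (n + 1)) (u : Fin (n + 1) → (RatFunc (FractionRing A))ˣ),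
      (∀ i, (u i : RatFunc (FractionRing A)) =
        algebraMap (Polynomial (FractionRing A)) (RatFunc (FractionRing A))
          ((p.1 i).map (algebraMap A (FractionRing A)))) →
      N (KtSymbol p) = MilnorSymbol u)
    (π' : Polynomial (FractionRing A)) (hπ'monic : π'.Monic) (hπ'irr : Irreducible π')
    (hπ'notA : ¬ ∃ q : A[X], q.map (algebraMap A (FractionRing A)) = π')
    (D' : MilnorK (RatFunc (FractionRing A)) (n + 1) →+
      MilnorK (Polynomial (FractionRing A) ⧸ Ideal.span {π'}) n)
    (hD' : IsTameSymbol (FractionRing A) n π' D') :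
    ∀ z : Kt A (n + 1), D' (N z) = 0 := by
  intro z
  obtain ⟨w, rfl⟩ := QuotientAddGroup.mk_surjective z
  suffices h : ((D'.comp N).comp (QuotientAddGroup.mk' (KtRel A (n + 1)))) = 0 from
    DFunLike.congr_fun h w
  refine FreeAbelianGroup.lift_ext _ _ fun p => ?_
  have hinj := IsFractionRing.injective A (FractionRing A)
  let u : Fin (n + 1) → (RatFunc (FractionRing A))ˣ := fun i =>
    Units.mk0 (algebraMap (Polynomial (FractionRing A)) (RatFunc (FractionRing A))
      ((p.1 i).map (algebraMap A (FractionRing A)))) <| by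
        refine RatFunc.algebraMap_ne_zero ((Polynomial.map_ne_zero_iff hinj).2 fun h0 => ?_)
        simpa [h0] using p.2.1 i
  change D' (N (KtSymbol p)) = 0
  rw [hN p u fun _ => rfl]
  exact hD'.2 _ (fun i => isCoprime_map_of_isUnit_leadingCoeff (p.2.1 i) hπ'monic hπ'irr hπ'notA)
    u fun _ => rfl
end

section
/- Norm compatibility with image subgroups: let A be a semilocal UFD with infinite residue fields, F = Q(A), π ∈ A[t] monic irreducible, B = A[t]/(π) (assumed a domain), L = Q(B), with natural maps i : A → F and j : B → L. Then the Bass–Tate norm satisfies N_{L/F}(im(j_* : K^M_n(B) → K^M_n(L))) ⊆ im(i_* : K^M_n(A) → K^M_n(F)). -/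
open Polynomial

/-- Tame symbol `∂_{1/t}` at the place at infinity of `F(t)/F`. -/
def IsTameSymbolInf (F : Type*) [Field F] (n : ℕ)
    (D : MilnorK (RatFunc F) (n + 1) →+ MilnorK F n) : Prop :=
  (∀ q : Fin n → F[X], (∀ i, (q i).coeff 0 ≠ 0) →
    ∀ (u : Fin (n + 1) → (RatFunc F)ˣ) (v : Fin n → Fˣ),
      (u 0 : RatFunc F) = (RatFunc.X)⁻¹ →
      (∀ i : Fin n, (u i.succ : RatFunc F) = Polynomial.aeval (RatFunc.X)⁻¹ (q i)) →
      (∀ i, (v i : F) = (q i).coeff 0) →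
      D (MilnorSymbol u) = MilnorSymbol v) ∧
  (∀ q : Fin (n + 1) → F[X], (∀ i, (q i).coeff 0 ≠ 0) →
    ∀ u : Fin (n + 1) → (RatFunc F)ˣ,
      (∀ i, (u i : RatFunc F) = Polynomial.aeval (RatFunc.X)⁻¹ (q i)) →
      D (MilnorSymbol u) = 0)

namespace MilnorK

open Function

section Basic

variable {R : Type*} [CommRing R] {n : ℕ}

theorem closure_range_symbol :
    AddSubgroup.closure (Set.range (MilnorSymbol : (Fin n → Rˣ) → MilnorK R n)) = ⊤ := by
  rw [eq_top_iff]
  rintro x -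
  obtain ⟨y, rfl⟩ := QuotientAddGroup.mk_surjective x
  induction y using FreeAbelianGroup.induction_on with
  | zero => exact zero_mem _
  | of x => exact AddSubgroup.subset_closure ⟨x, rfl⟩
  | neg x h => exact neg_mem h
  | add x y hx hy => exact add_mem hx hy

theorem mem_of_symbol_mem {H : AddSubgroup (MilnorK R n)} (h : ∀ f, MilnorSymbol f ∈ H)
    (x : MilnorK R n) : x ∈ H := by
  have : AddSubgroup.closure (Set.range (MilnorSymbol : (Fin n → Rˣ) → MilnorK R n)) ≤ H := by
    rw [AddSubgroup.closure_le]
    rintro _ ⟨f, rfl⟩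
    exact h f
  rw [closure_range_symbol] at this
  exact this (AddSubgroup.mem_top x)

theorem hom_ext {G : Type*} [AddCommGroup G] {φ ψ : MilnorK R n →+ G}
    (h : ∀ f, φ (MilnorSymbol f) = ψ (MilnorSymbol f)) : φ = ψ :=
  AddMonoidHom.ext fun x => mem_of_symbol_mem (H := AddMonoidHom.eqLocus φ ψ) h x

/-- The universal property of `MilnorK`. -/
def lift {G : Type*} [AddCommGroup G] (s : (Fin n → Rˣ) → G)
    (hmul : ∀ (f : Fin n → Rˣ) (i : Fin n) (a b : Rˣ),
      s (update f i (a * b)) = s (update f i a) + s (update f i b))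
    (hst : ∀ (f : Fin n → Rˣ) (i j : Fin n), (i : ℕ) + 1 = j →
      ((f i : R) + f j = 1 ∨ (f i : R) + f j = 0) → s f = 0) : MilnorK R n →+ G :=
  QuotientAddGroup.lift (MilnorRel R n) (FreeAbelianGroup.lift s) <| by
    unfold MilnorRel
    rw [AddSubgroup.closure_le]
    rintro x (⟨f, i, a, b, hf, rfl⟩ | ⟨f, i, j, hij, hf, rfl⟩)
    · have := hmul f i a b
      rw [← hf, update_eq_self] at this
      simp [this]
    · simpa using hst f i j hij hf

theorem lift_symbol {G : Type*} [AddCommGroup G] (s : (Fin n → Rˣ) → G) (hmul) (hst)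
    (f : Fin n → Rˣ) : lift s hmul hst (MilnorSymbol f) = s f :=
  FreeAbelianGroup.lift_apply_of s f

theorem symbol_update_mul (f : Fin n → Rˣ) (i : Fin n) (a b : Rˣ) :
    MilnorSymbol (update f i (a * b)) =
      MilnorSymbol (update f i a) + MilnorSymbol (update f i b) := by
  rw [← sub_eq_zero, ← sub_sub]
  refine (QuotientAddGroup.eq_zero_iff (N := MilnorRel R n) _).2 (AddSubgroup.subset_closure ?_)
  exact Or.inl ⟨update f i (a * b), i, a, b, by simp, by simp⟩

theorem symbol_eq_zero_of_adjacent (f : Fin n → Rˣ) {i j : Fin n} (hij : (i : ℕ) + 1 = j)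
    (h : (f i : R) + f j = 1 ∨ (f i : R) + f j = 0) : MilnorSymbol f = 0 :=
  (QuotientAddGroup.eq_zero_iff (N := MilnorRel R n) _).2
    (AddSubgroup.subset_closure (Or.inr ⟨f, i, j, hij, h, rfl⟩))

/-- The symbol as a homomorphism in the `i`-th slot. -/
def slot (f : Fin n → Rˣ) (i : Fin n) : Additive Rˣ →+ MilnorK R n :=
  AddMonoidHom.mk' (fun a => MilnorSymbol (update f i a.toMul)) fun a b =>
    symbol_update_mul f i a.toMul b.toMul

theorem symbol_update_one (f : Fin n → Rˣ) (i : Fin n) : MilnorSymbol (update f i 1) = 0 :=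
  map_zero (slot f i)

theorem symbol_update_inv (f : Fin n → Rˣ) (i : Fin n) (a : Rˣ) :
    MilnorSymbol (update f i a⁻¹) = -MilnorSymbol (update f i a) :=
  map_neg (slot f i) (Additive.ofMul a)

theorem symbol_update_div (f : Fin n → Rˣ) (i : Fin n) (a b : Rˣ) :
    MilnorSymbol (update f i (a / b)) =
      MilnorSymbol (update f i a) - MilnorSymbol (update f i b) :=
  map_sub (slot f i) (Additive.ofMul a) (Additive.ofMul b)

/-- The symbol with the entries `x`, `y` in the slots `i`, `j` of `f`. -/
def pair (f : Fin n → Rˣ) (i j : Fin n) (x y : Rˣ) : MilnorK R n :=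
  MilnorSymbol (update (update f i x) j y)

theorem pair_self (f : Fin n → Rˣ) (i j : Fin n) : pair f i j (f i) (f j) = MilnorSymbol f := by
  simp [pair]

variable (f : Fin n → Rˣ) {i j : Fin n}

theorem pair_mul_right (x y z : Rˣ) : pair f i j x (y * z) = pair f i j x y + pair f i j x z :=
  symbol_update_mul _ _ _ _

theorem pair_div_right (x y z : Rˣ) : pair f i j x (y / z) = pair f i j x y - pair f i j x z :=
  symbol_update_div _ _ _ _

theorem pair_mul_left (h : i ≠ j) (x y z : Rˣ) :
    pair f i j (x * y) z = pair f i j x z + pair f i j y z := by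
  simp only [pair, update_comm h, symbol_update_mul]

theorem pair_div_left (h : i ≠ j) (x y z : Rˣ) :
    pair f i j (x / y) z = pair f i j x z - pair f i j y z := by
  simp only [pair, update_comm h, symbol_update_div]

theorem symbol_comp_swap_of_adjacent (hij : (i : ℕ) + 1 = j) :
    MilnorSymbol (f ∘ Equiv.swap i j) = -MilnorSymbol f := by
  have hne : i ≠ j := by rintro rfl; omega
  have h0 : ∀ x, pair f i j x (-x) = 0 := fun x =>
    symbol_eq_zero_of_adjacent _ hij (Or.inr (by simp [update_of_ne hne]))
  have h1 : pair f i j (f j) (f i) + pair f i j (f i) (f j) = 0 := by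
    have ha : pair f i j (f i) (-(f i * f j)) = pair f i j (f i) (f j) := by
      rw [← neg_mul, pair_mul_right, h0, zero_add]
    have hb : pair f i j (f j) (-(f i * f j)) = pair f i j (f j) (f i) := by
      rw [← mul_neg, pair_mul_right, h0, add_zero]
    rw [← ha, ← hb, add_comm, ← pair_mul_left f hne, h0]
  rw [pair_self] at h1
  rw [← eq_neg_of_add_eq_zero_left h1, pair]
  congr 1
  ext k
  by_cases hk : k = j
  · subst hk; simp
  · by_cases hk' : k = i
    · subst hk'; simp [update_of_ne hk]
    · simp [update_of_ne hk, update_of_ne hk', Equiv.swap_apply_of_ne_of_ne hk' hk]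

theorem symbol_comp_perm (σ : Equiv.Perm (Fin n)) (f : Fin n → Rˣ) :
    MilnorSymbol (f ∘ σ) = MilnorSymbol f ∨ MilnorSymbol (f ∘ σ) = -MilnorSymbol f := by
  rcases n with - | n
  · exact Or.inl (congrArg _ (Subsingleton.elim _ _))
  have hσ : σ ∈ Submonoid.closure (Set.range fun i : Fin n => Equiv.swap i.castSucc i.succ) := by
    rw [Equiv.Perm.mclosure_swap_castSucc_succ]
    trivial
  induction hσ using Submonoid.closure_induction generalizing f with
  | mem σ h =>
    obtain ⟨i, rfl⟩ := h
    exact Or.inr (symbol_comp_swap_of_adjacent f (by simp))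
  | one => exact Or.inl rfl
  | mul σ τ _ _ hσ hτ =>
    have : f ∘ ⇑(σ * τ) = (f ∘ σ) ∘ τ := rfl
    rw [this]
    rcases hσ f with h | h <;> rcases hτ (f ∘ σ) with h' | h' <;> simp [h, h']

theorem symbol_comp_perm_mem {H : AddSubgroup (MilnorK R n)} (σ : Equiv.Perm (Fin n))
    (h : MilnorSymbol (f ∘ σ) ∈ H) : MilnorSymbol f ∈ H := by
  rcases symbol_comp_perm σ f with h' | h' <;> rw [h'] at h
  · exact h
  · exact neg_mem_iff.1 h

theorem symbol_eq_zero (hij : i ≠ j) (h : (f i : R) + f j = 1 ∨ (f i : R) + f j = 0) :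
    MilnorSymbol f = 0 := by
  obtain _ | _ | n := n
  · exact i.elim0
  · exact absurd (Fin.ext (by omega)) hij
  set τ := Equiv.swap 0 i
  have hτ : τ j ≠ 0 := fun h0 => hij (by
    simpa [τ] using (congrArg τ h0).symm)
  set σ := τ * Equiv.swap 1 (τ j)
  have h0 : σ 0 = i := by
    simp [σ, Equiv.swap_apply_of_ne_of_ne Fin.zero_ne_one hτ.symm, τ]
  have h1 : σ 1 = j := by simp [σ, τ]
  have := symbol_eq_zero_of_adjacent (f ∘ σ) (i := 0) (j := 1) rfl (by simpa [h0, h1] using h)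
  exact symbol_comp_perm_mem (H := ⊥) f σ (by simpa using this)

theorem pair_neg (h : i ≠ j) (x : Rˣ) : pair f i j x (-x) = 0 :=
  symbol_eq_zero _ h (Or.inr (by simp [update_of_ne h]))

theorem pair_same (h : i ≠ j) (x : Rˣ) : pair f i j x x = pair f i j x (-1) := by
  rw [← sub_eq_zero, ← pair_div_right, div_eq_mul_inv, inv_neg_one, mul_neg_one, pair_neg f h]

theorem pair_of_eq_add (h : i ≠ j) {x y z : Rˣ} (hx : (x : R) = y + z) :
    pair f i j x y = pair f i j z y - pair f i j z x + pair f i j x (-1) := by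
  have h0 : pair f i j (z / x) (y / x) = 0 := by
    refine symbol_eq_zero _ h (Or.inl ?_)
    simp only [update_of_ne h, update_self, div_eq_mul_inv, Units.val_mul]
    rw [← add_mul, add_comm (z : R), ← hx, Units.mul_inv]
  rw [pair_div_right, pair_div_left f h, pair_div_left f h, pair_same f h x] at h0
  rw [← sub_eq_zero, ← neg_eq_zero, ← h0]
  abel

/-- Multilinear expansion of symbols. -/
theorem symbol_mem_of_mem_closure {H : AddSubgroup (MilnorK R n)} (T : Fin n → Set Rˣ)
    (hT : ∀ g : Fin n → Rˣ, (∀ i, g i ∈ T i) → MilnorSymbol g ∈ H)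
    (hf : ∀ i, f i ∈ Subgroup.closure (T i)) : MilnorSymbol f ∈ H := by
  suffices key : ∀ (s : Finset (Fin n)) (f : Fin n → Rˣ),
      (∀ i ∈ s, f i ∈ Subgroup.closure (T i)) → (∀ i ∉ s, f i ∈ T i) → MilnorSymbol f ∈ H from
    key Finset.univ f (fun i _ => hf i) (by simp)
  intro s
  induction s using Finset.induction_on with
  | empty => exact fun f _ h => hT f fun i => h i (Finset.notMem_empty i)
  | insert i s hi ih =>
    intro f h1 h2
    suffices ∀ x ∈ Subgroup.closure (T i), MilnorSymbol (update f i x) ∈ H by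
      simpa using this (f i) (h1 i (Finset.mem_insert_self i s))
    intro x hx
    induction hx using Subgroup.closure_induction with
    | mem x hx =>
      refine ih _ (fun k hk => ?_) fun k hk => ?_
      · rw [update_of_ne (ne_of_mem_of_not_mem hk hi)]
        exact h1 k (Finset.mem_insert_of_mem hk)
      · by_cases hki : k = i
        · subst hki; simpa using hx
        · rw [update_of_ne hki]
          exact h2 k (by simp [hki, hk])
    | one => simp [symbol_update_one]
    | mul x y _ _ hx hy => rw [symbol_update_mul]; exact add_mem hx hy
    | inv x _ hx => rw [symbol_update_inv]; exact neg_mem hx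

/-- Functoriality of `MilnorK`. -/
def map {S : Type*} [CommRing S] (φ : R →+* S) : MilnorK R n →+ MilnorK S n :=
  lift (fun f => MilnorSymbol fun i => Units.map φ.toMonoidHom (f i))
    (fun f i a b => by
      have h : ∀ x, (fun k => Units.map φ.toMonoidHom (update f i x k)) =
          update (fun k => Units.map φ.toMonoidHom (f k)) i (Units.map φ.toMonoidHom x) :=
        fun x => by
          ext k
          by_cases hk : k = i
          · subst hk; simp
          · simp [update_of_ne hk]
      simp only [h, map_mul, symbol_update_mul])
    (fun f i j hij h => symbol_eq_zero_of_adjacent _ hij (by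
      simp only [Units.coe_map, RingHom.toMonoidHom_eq_coe, MonoidHom.coe_coe, ← map_add]
      rcases h with h | h <;> simp [h]))

theorem map_symbol {S : Type*} [CommRing S] (φ : R →+* S) (f : Fin n → Rˣ) :
    map φ (MilnorSymbol f) = MilnorSymbol fun i => Units.map φ.toMonoidHom (f i) :=
  lift_symbol _ _ _ f

end Basic

section RationalFunctions

variable {F : Type*} [Field F] {n : ℕ}

open Classical in
/-- A nonzero polynomial as a unit of the field of rational functions (and `1` for `p = 0`). -/
noncomputable def polyUnit (p : F[X]) : (RatFunc F)ˣ :=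
  if h : p = 0 then 1 else
    Units.mk0 (algebraMap F[X] (RatFunc F) p) (by simpa using h)

theorem val_polyUnit {p : F[X]} (h : p ≠ 0) :
    (polyUnit p : RatFunc F) = algebraMap F[X] (RatFunc F) p := by
  simp [polyUnit, h]

theorem polyUnit_mul {p q : F[X]} (hp : p ≠ 0) (hq : q ≠ 0) :
    polyUnit (p * q) = polyUnit p * polyUnit q := by
  ext
  simp [val_polyUnit, hp, hq]

theorem polyUnit_neg_one : polyUnit (-1 : F[X]) = -1 := by
  ext
  simp [val_polyUnit]

theorem exists_eq_polyUnit_div (u : (RatFunc F)ˣ) :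
    ∃ p q : F[X], p ≠ 0 ∧ q ≠ 0 ∧ u = polyUnit p / polyUnit q := by
  refine ⟨(u : RatFunc F).num, (u : RatFunc F).denom, RatFunc.num_ne_zero u.ne_zero,
    RatFunc.denom_ne_zero _, ?_⟩
  ext
  rw [Units.val_div_eq_div_val, val_polyUnit (RatFunc.num_ne_zero u.ne_zero),
    val_polyUnit (RatFunc.denom_ne_zero _), RatFunc.num_div_denom]

/-- Nonzero polynomials of degree less than `d`, as rational functions. -/
def smallUnits (F : Type*) [Field F] (d : ℕ) : Set (RatFunc F)ˣ :=
  {u | ∃ p : F[X], p ≠ 0 ∧ p.natDegree < d ∧ u = polyUnit p}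

/-- Monic irreducible polynomials of degree `d`, as rational functions. -/
def primeUnits (F : Type*) [Field F] (d : ℕ) : Set (RatFunc F)ˣ :=
  {u | ∃ p : F[X], p.Monic ∧ Irreducible p ∧ p.natDegree = d ∧ u = polyUnit p}

theorem smallUnits_mono {d e : ℕ} (h : d ≤ e) : smallUnits F d ⊆ smallUnits F e :=
  fun _ ⟨p, h0, h1, h2⟩ => ⟨p, h0, h1.trans_le h, h2⟩

/-- The subgroup of `K_n(F(t))` generated by symbols of polynomials of degree less than `d`. -/
noncomputable def filtration (F : Type*) [Field F] (n d : ℕ) :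
    AddSubgroup (MilnorK (RatFunc F) n) :=
  AddSubgroup.closure {x | ∃ f : Fin n → (RatFunc F)ˣ, (∀ i, f i ∈ smallUnits F d) ∧
    x = MilnorSymbol f}

theorem symbol_mem_filtration {d : ℕ} {f : Fin n → (RatFunc F)ˣ}
    (hf : ∀ i, f i ∈ Subgroup.closure (smallUnits F d)) : MilnorSymbol f ∈ filtration F n d :=
  symbol_mem_of_mem_closure f _ (fun g hg => AddSubgroup.subset_closure ⟨g, hg, rfl⟩) hf

theorem filtration_mono {d e : ℕ} (h : d ≤ e) : filtration F n d ≤ filtration F n e :=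
  AddSubgroup.closure_mono fun _ ⟨f, hf, hx⟩ => ⟨f, fun i => smallUnits_mono h (hf i), hx⟩

theorem exists_mem_filtration (x : MilnorK (RatFunc F) n) : ∃ d, x ∈ filtration F n (d + 1) := by
  have hdir : Monotone fun d => filtration F n (d + 1) :=
    fun d e h => filtration_mono (Nat.succ_le_succ h)
  rw [← AddSubgroup.mem_iSup_of_directed hdir.directed_le]
  refine mem_of_symbol_mem (fun f => ?_) x
  rw [AddSubgroup.mem_iSup_of_directed hdir.directed_le]
  choose p q hp hq h using fun i => exists_eq_polyUnit_div (f i)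
  refine ⟨Finset.univ.sup fun i => (p i).natDegree + (q i).natDegree, symbol_mem_filtration
    fun i => ?_⟩
  have hle := Finset.le_sup (f := fun i => (p i).natDegree + (q i).natDegree) (Finset.mem_univ i)
  rw [h i]
  refine div_mem (Subgroup.subset_closure ⟨p i, hp i, ?_, rfl⟩)
    (Subgroup.subset_closure ⟨q i, hq i, ?_, rfl⟩) <;> grind

/-- The representative of degree less than `deg q` of a residue class modulo `q`. -/
noncomputable def rep (q : F[X]) (x : F[X] ⧸ Ideal.span {q}) : F[X] :=
  (Ideal.Quotient.mk_surjective x).choose %ₘ q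

variable {q : F[X]}

theorem mk_modByMonic (p : F[X]) :
    Ideal.Quotient.mk (Ideal.span {q}) (p %ₘ q) = Ideal.Quotient.mk (Ideal.span {q}) p := by
  rw [Ideal.Quotient.eq, Ideal.mem_span_singleton]
  exact ⟨-(p /ₘ q), by linear_combination modByMonic_add_div p q⟩

theorem mk_rep (x : F[X] ⧸ Ideal.span {q}) : Ideal.Quotient.mk (Ideal.span {q}) (rep q x) = x := by
  rw [rep, mk_modByMonic, (Ideal.Quotient.mk_surjective x).choose_spec]

theorem degree_rep_lt (hq : q.Monic) (x : F[X] ⧸ Ideal.span {q}) : (rep q x).degree < q.degree :=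
  degree_modByMonic_lt _ hq

theorem eq_of_mk_eq {p p' : F[X]} (hp : p.degree < q.degree) (hp' : p'.degree < q.degree)
    (h : Ideal.Quotient.mk (Ideal.span {q}) p = Ideal.Quotient.mk (Ideal.span {q}) p') :
    p = p' := by
  rw [Ideal.Quotient.eq, Ideal.mem_span_singleton] at h
  exact sub_eq_zero.1 (eq_zero_of_dvd_of_degree_lt h ((degree_sub_le _ _).trans_lt (max_lt hp hp')))

theorem rep_ne_zero (hirr : Irreducible q) (x : (F[X] ⧸ Ideal.span {q})ˣ) :
    rep q (x : F[X] ⧸ Ideal.span {q}) ≠ 0 := by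
  intro h
  have : Nontrivial (F[X] ⧸ Ideal.span {q}) :=
    Ideal.Quotient.nontrivial_iff.2 (by rw [Ne, Ideal.span_singleton_eq_top]; exact hirr.not_isUnit)
  have h' := mk_rep (x : F[X] ⧸ Ideal.span {q})
  rw [h, map_zero] at h'
  exact x.ne_zero h'.symm

theorem polyUnit_rep_mem (hq : q.Monic) (hirr : Irreducible q) (x : (F[X] ⧸ Ideal.span {q})ˣ) :
    polyUnit (rep q (x : F[X] ⧸ Ideal.span {q})) ∈ smallUnits F q.natDegree :=
  ⟨_, rep_ne_zero hirr x, natDegree_lt_natDegree (rep_ne_zero hirr x) (degree_rep_lt hq _), rfl⟩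

/-- The symbol `{q, g_1, …, g_n}` where the `g_i` are the reduced representatives of `f_i`. -/
noncomputable def prependSymbol (q : F[X]) (f : Fin n → (F[X] ⧸ Ideal.span {q})ˣ) :
    MilnorK (RatFunc F) (n + 1) :=
  MilnorSymbol (Fin.cons (polyUnit q) fun i => polyUnit (rep q (f i : F[X] ⧸ Ideal.span {q})))

theorem prependSymbol_update (f : Fin n → (F[X] ⧸ Ideal.span {q})ˣ) (i : Fin n)
    (x : (F[X] ⧸ Ideal.span {q})ˣ) :
    prependSymbol q (update f i x) =
      MilnorSymbol (update (Fin.cons (polyUnit q) fun i =>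
          polyUnit (rep q (f i : F[X] ⧸ Ideal.span {q}))) i.succ
        (polyUnit (rep q (x : F[X] ⧸ Ideal.span {q})))) := by
  rw [← Fin.cons_update, prependSymbol]
  congr 2
  ext k
  by_cases hk : k = i
  · subst hk; simp
  · simp [update_of_ne hk]

theorem prependSymbol_mul_mem (hq : q.Monic) (hirr : Irreducible q)
    (f : Fin n → (F[X] ⧸ Ideal.span {q})ˣ) (i : Fin n) (a b : (F[X] ⧸ Ideal.span {q})ˣ) :
    prependSymbol q (update f i (a * b)) - prependSymbol q (update f i a)
      - prependSymbol q (update f i b) ∈ filtration F (n + 1) q.natDegree := by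
  simp only [prependSymbol_update]
  set w : Fin (n + 1) → (RatFunc F)ˣ :=
    Fin.cons (polyUnit q) fun i => polyUnit (rep q (f i : F[X] ⧸ Ideal.span {q})) with hw
  set r := rep q ((a * b : (F[X] ⧸ Ideal.span {q})ˣ) : F[X] ⧸ Ideal.span {q}) with hr
  have ha := rep_ne_zero hirr a
  have hb := rep_ne_zero hirr b
  have hr0 : r ≠ 0 := rep_ne_zero hirr (a * b)
  have hsmall := fun x : (F[X] ⧸ Ideal.span {q})ˣ =>
    Subgroup.subset_closure (polyUnit_rep_mem hq hirr x)
  have hda := degree_rep_lt hq (a : F[X] ⧸ Ideal.span {q})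
  have hdb := degree_rep_lt hq (b : F[X] ⧸ Ideal.span {q})
  set s := rep q (a : F[X] ⧸ Ideal.span {q}) * rep q (b : F[X] ⧸ Ideal.span {q}) with hs
  have hs0 : s ≠ 0 := mul_ne_zero ha hb
  have hsu := polyUnit_mul ha hb
  rw [← hs] at hsu
  rw [sub_sub, ← symbol_update_mul, ← hsu, ← symbol_update_div]
  have hrs : s = r + q * (s /ₘ q) := by
    have : s %ₘ q = r := by
      refine eq_of_mk_eq (degree_modByMonic_lt _ hq) (degree_rep_lt hq _) ?_
      rw [mk_modByMonic, hs, map_mul, mk_rep, mk_rep, hr, mk_rep, Units.val_mul]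
    rw [← this, modByMonic_add_div]
  set c := s /ₘ q with hc
  by_cases hc0 : c = 0
  · rw [hc0, mul_zero, add_zero] at hrs
    rw [← hrs, div_self', symbol_update_one]
    exact zero_mem _
  have hne : (0 : Fin (n + 1)) ≠ i.succ := (Fin.succ_ne_zero i).symm
  have h0 : pair w 0 i.succ (polyUnit q * (polyUnit c / polyUnit s)) (polyUnit r / polyUnit s)
      = 0 := by
    refine symbol_eq_zero _ hne (Or.inl ?_)
    have hsne : algebraMap F[X] (RatFunc F) s ≠ 0 := by simpa using hs0
    simp only [update_of_ne hne, update_self, Units.val_mul, Units.val_div_eq_div_val,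
      val_polyUnit hq.ne_zero, val_polyUnit hc0, val_polyUnit hs0, val_polyUnit hr0]
    rw [← mul_div_assoc, ← add_div, div_eq_one_iff_eq hsne, ← map_mul, ← map_add, add_comm,
      ← hrs]
  rw [pair_mul_left _ hne] at h0
  have hq' : pair w 0 i.succ (polyUnit q) (polyUnit r / polyUnit s) =
      MilnorSymbol (update w i.succ (polyUnit r / polyUnit s)) := by
    rw [pair]
    congr 2
    exact update_eq_self 0 w
  rw [← hq', eq_neg_of_add_eq_zero_left h0]
  refine neg_mem (symbol_mem_filtration fun k => ?_)
  have hsmem : polyUnit s ∈ Subgroup.closure (smallUnits F q.natDegree) :=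
    hsu ▸ mul_mem (hsmall a) (hsmall b)
  have hcmem : polyUnit c ∈ Subgroup.closure (smallUnits F q.natDegree) := by
    refine Subgroup.subset_closure ⟨c, hc0, ?_, rfl⟩
    have h1 := natDegree_divByMonic s hq
    have h2 := natDegree_mul ha hb
    have h3 := natDegree_lt_natDegree ha hda
    have h4 := natDegree_lt_natDegree hb hdb
    rw [← hs] at h2
    rw [← hc] at h1
    omega
  by_cases hk : k = i.succ
  · subst hk
    rw [update_self]
    exact div_mem (hsmall (a * b)) hsmem
  · rw [update_of_ne hk]
    by_cases hk0 : k = 0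
    · subst hk0
      rw [update_self]
      exact div_mem hcmem hsmem
    · rw [update_of_ne hk0]
      obtain ⟨k, rfl⟩ := Fin.exists_succ_eq.2 hk0
      exact hsmall (f k)

/-- The map `K_n(F[t]/(q)) → K_{n+1}(F(t))` prepending `q`, which is well defined modulo
symbols of polynomials of degree less than `deg q`. -/
noncomputable def prepend (hq : q.Monic) (hirr : Irreducible q) :
    MilnorK (F[X] ⧸ Ideal.span {q}) n →+
      MilnorK (RatFunc F) (n + 1) ⧸ filtration F (n + 1) q.natDegree :=
  lift (fun f => QuotientAddGroup.mk (prependSymbol q f))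
    (fun f i a b => by
      rw [← sub_eq_zero, ← sub_sub]
      exact (QuotientAddGroup.eq_zero_iff _).2 (prependSymbol_mul_mem hq hirr f i a b))
    (fun f i j hij h => by
      refine (QuotientAddGroup.eq_zero_iff _).2 ?_
      have hi := rep_ne_zero hirr (f i)
      have hj := rep_ne_zero hirr (f j)
      suffices prependSymbol q f = 0 from this ▸ zero_mem _
      refine symbol_eq_zero_of_adjacent _ (i := i.succ) (j := j.succ) (by simpa using hij) ?_
      simp only [Fin.cons_succ, val_polyUnit hi, val_polyUnit hj, ← map_add]
      have hd : (rep q (f i : F[X] ⧸ Ideal.span {q}) + rep q (f j : F[X] ⧸ Ideal.span {q})).degree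
          < q.degree :=
        (degree_add_le _ _).trans_lt (max_lt (degree_rep_lt hq _) (degree_rep_lt hq _))
      refine h.imp (fun h => ?_) fun h => ?_
      · rw [eq_of_mk_eq hd (p' := 1) (by
          rw [degree_one]; exact degree_pos_of_irreducible hirr)
          (by rw [map_add, mk_rep, mk_rep, h, map_one]), map_one]
      · rw [eq_of_mk_eq hd (p' := 0) (by
          rw [degree_zero]; exact bot_lt_iff_ne_bot.2 (by simpa using hirr.ne_zero))
          (by rw [map_add, mk_rep, mk_rep, h, map_zero]), map_zero])

theorem prepend_symbol (hq : q.Monic) (hirr : Irreducible q)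
    (f : Fin n → (F[X] ⧸ Ideal.span {q})ˣ) :
    prepend hq hirr (MilnorSymbol f) = QuotientAddGroup.mk (prependSymbol q f) :=
  lift_symbol _ _ _ f

end RationalFunctions

section Exactness

variable {F : Type*} [Field F] {n : ℕ}

theorem ne_zero_of_isCoprime {q p : F[X]} (hirr : Irreducible q) (h : IsCoprime p q) : p ≠ 0 := by
  rintro rfl
  exact hirr.not_isUnit (isCoprime_zero_left.1 h)

theorem isCoprime_of_degree_lt {q p : F[X]} (hirr : Irreducible q) (hp : p ≠ 0)
    (h : p.natDegree < q.natDegree) : IsCoprime p q := by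
  refine ((hirr.coprime_iff_not_dvd).2 fun hd => ?_).symm
  exact absurd (natDegree_le_of_dvd hd hp) h.not_ge

theorem isCoprime_of_ne {q p : F[X]} (hq : q.Monic) (hirr : Irreducible q) (hp : p.Monic)
    (hpirr : Irreducible p) (h : p ≠ q) : IsCoprime p q := by
  refine (hpirr.coprime_iff_not_dvd).2 fun hd => h ?_
  exact eq_of_monic_of_associated hp hq (hpirr.associated_of_dvd hirr hd)

/-- The residue class of a polynomial coprime to `q`, as a unit. -/
noncomputable def residueUnit {R : Type*} [CommRing R] {q p : R[X]} (h : IsCoprime p q) :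
    (R[X] ⧸ Ideal.span {q})ˣ :=
  IsUnit.unit (a := Ideal.Quotient.mk (Ideal.span {q}) p) (by
    obtain ⟨a, b, hab⟩ := h
    refine IsUnit.of_mul_eq_one (Ideal.Quotient.mk (Ideal.span {q}) a) ?_
    rw [← map_mul, ← map_one (Ideal.Quotient.mk (Ideal.span {q})), Ideal.Quotient.eq,
      Ideal.mem_span_singleton]
    exact ⟨-b, by linear_combination hab⟩)

theorem val_residueUnit {R : Type*} [CommRing R] {q p : R[X]} (h : IsCoprime p q) :
    (residueUnit h : R[X] ⧸ Ideal.span {q}) = Ideal.Quotient.mk (Ideal.span {q}) p := rfl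

theorem tame_cons {q : F[X]} (hirr : Irreducible q)
    {D : MilnorK (RatFunc F) (n + 1) →+ MilnorK (F[X] ⧸ Ideal.span {q}) n}
    (hD : IsTameSymbol F n q D) (p : Fin n → F[X]) (hp : ∀ i, IsCoprime (p i) q) :
    D (MilnorSymbol (Fin.cons (polyUnit q) fun i => polyUnit (p i))) =
      MilnorSymbol fun i => residueUnit (hp i) :=
  hD.1 p hp _ _ (by simp [val_polyUnit hirr.ne_zero])
    (fun i => by simp [val_polyUnit (ne_zero_of_isCoprime hirr (hp i))]) fun i => rfl

theorem tame_eq_zero {q : F[X]} (hirr : Irreducible q)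
    {D : MilnorK (RatFunc F) (n + 1) →+ MilnorK (F[X] ⧸ Ideal.span {q}) n}
    (hD : IsTameSymbol F n q D) (f : Fin (n + 1) → (RatFunc F)ˣ)
    (hf : ∀ i, ∃ p, IsCoprime p q ∧ f i = polyUnit p) : D (MilnorSymbol f) = 0 := by
  choose p hp hfp using hf
  exact hD.2 p hp f fun i => by rw [hfp, val_polyUnit (ne_zero_of_isCoprime hirr (hp i))]

theorem polyUnit_mem_closure {d : ℕ} (hd : 1 ≤ d) {p : F[X]} (hp : p ≠ 0)
    (h : p.natDegree < d + 1) :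
    polyUnit p ∈ Subgroup.closure (smallUnits F d ∪ primeUnits F d) := by
  have small : ∀ {p : F[X]}, p ≠ 0 → p.natDegree < d →
      polyUnit p ∈ Subgroup.closure (smallUnits F d ∪ primeUnits F d) := fun {p} h0 h1 =>
    Subgroup.subset_closure (Or.inl ⟨p, h0, h1, rfl⟩)
  rcases Nat.lt_or_ge p.natDegree d with hlt | hge
  · exact small hp hlt
  have hdeg : p.natDegree = d := by omega
  by_cases hirr : Irreducible p
  · have hlc : p.leadingCoeff ≠ 0 := by simpa using hp
    have hC : (C p.leadingCoeff) ≠ (0 : F[X]) := by simpa using hp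
    have hm : (p * C p.leadingCoeff⁻¹).Monic := monic_mul_leadingCoeff_inv hp
    have heq : p = C p.leadingCoeff * (p * C p.leadingCoeff⁻¹) := by
      rw [mul_left_comm, ← C_mul, mul_inv_cancel₀ hlc, C_1, mul_one]
    have hassoc : Associated p (p * C p.leadingCoeff⁻¹) :=
      associated_mul_unit_right _ _ (isUnit_C.2 (inv_ne_zero hlc).isUnit)
    rw [heq, polyUnit_mul hC hm.ne_zero]
    refine mul_mem (small hC (by rw [natDegree_C]; exact hd)) (Subgroup.subset_closure (Or.inr ?_))
    exact ⟨_, hm, hassoc.irreducible hirr, by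
      rw [← hdeg]; exact (natDegree_eq_of_degree_eq (degree_eq_degree_of_associated hassoc)).symm,
      rfl⟩
  · have hu : ¬IsUnit p := fun hu => by
      have := natDegree_eq_zero_of_isUnit hu
      omega
    obtain ⟨a, b, ha, hb, hab⟩ : ∃ a b, ¬IsUnit a ∧ ¬IsUnit b ∧ p = a * b := by
      simp only [irreducible_iff, not_and, not_forall, not_or] at hirr
      obtain ⟨a, b, hab, ha, hb⟩ := hirr hu
      exact ⟨a, b, ha, hb, hab⟩
    have ha0 : a ≠ 0 := by rintro rfl; simp [hp] at hab
    have hb0 : b ≠ 0 := by rintro rfl; simp [hp] at hab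
    have h1 := natDegree_mul ha0 hb0
    have h2 := natDegree_pos_iff_degree_pos.2 (degree_pos_of_ne_zero_of_nonunit ha0 ha)
    have h3 := natDegree_pos_iff_degree_pos.2 (degree_pos_of_ne_zero_of_nonunit hb0 hb)
    rw [← hab] at h1
    rw [hab, polyUnit_mul ha0 hb0]
    exact mul_mem (small ha0 (by omega)) (small hb0 (by omega))

/-- The monic irreducible polynomials of degree `d`. -/
abbrev MonicIrreducible (F : Type*) [Field F] (d : ℕ) :=
  {q : F[X] // q.Monic ∧ Irreducible q ∧ q.natDegree = d}

/-- `prepend` with target indexed by the degree. -/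
noncomputable def prependOf {d : ℕ} (q : MonicIrreducible F d) :
    MilnorK (F[X] ⧸ Ideal.span {q.1}) n →+
      MilnorK (RatFunc F) (n + 1) ⧸ filtration F (n + 1) d :=
  (QuotientAddGroup.map _ _ (AddMonoidHom.id _)
    (by rw [q.2.2.2, AddSubgroup.comap_id])).comp (prepend q.2.1 q.2.2.1)

theorem prependOf_symbol {d : ℕ} (q : MonicIrreducible F d)
    (f : Fin n → (F[X] ⧸ Ideal.span {q.1})ˣ) :
    prependOf q (MilnorSymbol f) = QuotientAddGroup.mk (prependSymbol q.1 f) := by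
  rw [prependOf, AddMonoidHom.comp_apply, prepend_symbol]
  rfl

variable (D : ∀ q : F[X], MilnorK (RatFunc F) (n + 1) →+ MilnorK (F[X] ⧸ Ideal.span {q}) n)

open Classical in
/-- Elements which, modulo symbols of polynomials of degree less than `d`, are determined by their
tame symbols at the places of degree `d`. -/
noncomputable def determined (d : ℕ) : AddSubgroup (MilnorK (RatFunc F) (n + 1)) where
  carrier := {ζ | ∃ S : Finset (MonicIrreducible F d), (∀ q ∉ S, D q.1 ζ = 0) ∧
    (QuotientAddGroup.mk ζ : MilnorK (RatFunc F) (n + 1) ⧸ filtration F (n + 1) d) =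
      ∑ q ∈ S, prependOf q (D q.1 ζ)}
  zero_mem' := ⟨∅, by simp, by simp⟩
  neg_mem' := by
    rintro ζ ⟨S, h1, h2⟩
    exact ⟨S, fun q hq => by rw [map_neg, h1 q hq, neg_zero], by
      simp [QuotientAddGroup.mk_neg, h2]⟩
  add_mem' := by
    rintro ζ η ⟨S, h1, h2⟩ ⟨T, h3, h4⟩
    refine ⟨S ∪ T, fun q hq => ?_, ?_⟩
    · rw [Finset.notMem_union] at hq
      rw [map_add, h1 q hq.1, h3 q hq.2, add_zero]
    · have hS := Finset.sum_subset (f := fun q => prependOf q (D q.1 ζ))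
        (Finset.subset_union_left (s₁ := S) (s₂ := T)) fun q _ hq => by rw [h1 q hq, map_zero]
      have hT := Finset.sum_subset (f := fun q => prependOf q (D q.1 η))
        (Finset.subset_union_right (s₁ := S) (s₂ := T)) fun q _ hq => by rw [h3 q hq, map_zero]
      rw [QuotientAddGroup.mk_add, h2, h4, hS, hT]
      simp [Finset.sum_add_distrib]

variable {D}

theorem symbol_mem_determined
    (hD : ∀ q : F[X], q.Monic → Irreducible q → IsTameSymbol F n q (D q))
    {d : ℕ} (hd : 1 ≤ d) (s : Finset (Fin (n + 1)))
    (f : Fin (n + 1) → (RatFunc F)ˣ) (h1 : ∀ i ∈ s, f i ∈ primeUnits F d)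
    (h2 : ∀ i ∉ s, f i ∈ smallUnits F d) : MilnorSymbol f ∈ determined D d := by
  have neg_one_mem : (-1 : (RatFunc F)ˣ) ∈ smallUnits F d :=
    ⟨-1, by simp, by simpa using Nat.lt_of_succ_le hd, polyUnit_neg_one.symm⟩
  induction s using Finset.strongInduction generalizing f with
  | H s ih =>
    rcases s.eq_empty_or_nonempty with rfl | ⟨i, hi⟩
    · refine ⟨∅, fun q _ => ?_, ?_⟩
      · refine tame_eq_zero q.2.2.1 (hD _ q.2.1 q.2.2.1) f fun i => ?_
        obtain ⟨p, hp0, hpd, hfp⟩ := h2 i (Finset.notMem_empty i)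
        exact ⟨p, isCoprime_of_degree_lt q.2.2.1 hp0 (by rwa [q.2.2.2]), hfp⟩
      · rw [Finset.sum_empty, QuotientAddGroup.eq_zero_iff]
        exact symbol_mem_filtration fun i =>
          Subgroup.subset_closure (h2 i (Finset.notMem_empty i))
    by_cases hs : ∃ j ∈ s, i ≠ j
    · obtain ⟨j, hj, hij⟩ := hs
      have replace_right : ∀ x ∈ primeUnits F d, ∀ y ∈ smallUnits F d,
          pair f i j x y ∈ determined D d := fun x hx y hy => by
        refine ih (s.erase j) (Finset.erase_ssubset hj) _ (fun k hk => ?_) fun k hk => ?_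
        · obtain ⟨hkj, hks⟩ := Finset.mem_erase.1 hk
          by_cases hki : k = i
          · subst hki; simpa [update_of_ne hij] using hx
          · simpa [update_of_ne hkj, update_of_ne hki] using h1 k hks
        · by_cases hkj : k = j
          · subst hkj; simpa using hy
          · have hks : k ∉ s := fun h => hk (Finset.mem_erase.2 ⟨hkj, h⟩)
            have hki : k ≠ i := fun h => hks (h ▸ hi)
            simpa [update_of_ne hkj, update_of_ne hki] using h2 k hks
      have replace_left : ∀ x ∈ smallUnits F d, ∀ y ∈ primeUnits F d,
          pair f i j x y ∈ determined D d := fun x hx y hy => by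
        refine ih (s.erase i) (Finset.erase_ssubset hi) _ (fun k hk => ?_) fun k hk => ?_
        · obtain ⟨hki, hks⟩ := Finset.mem_erase.1 hk
          by_cases hkj : k = j
          · subst hkj; simpa using hy
          · simpa [update_of_ne hkj, update_of_ne hki] using h1 k hks
        · by_cases hki : k = i
          · subst hki; simpa [update_of_ne hij] using hx
          · have hks : k ∉ s := fun h => hk (Finset.mem_erase.2 ⟨hki, h⟩)
            have hkj : k ≠ j := fun h => hks (h ▸ hj)
            simpa [update_of_ne hkj, update_of_ne hki] using h2 k hks
      rw [← pair_self f i j]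
      obtain ⟨p, hpm, hpi, hpd, hfp⟩ := h1 i hi
      obtain ⟨q, hqm, hqi, hqd, hfq⟩ := h1 j hj
      by_cases hpq : p = q
      · rw [hfq, ← hpq, ← hfp, pair_same f hij]
        exact replace_right _ (h1 i hi) _ neg_one_mem
      · have hr : p - q ≠ 0 := sub_ne_zero.2 hpq
        have hrd : (p - q).natDegree < d := by
          have hdeg : p.degree = q.degree := by
            rw [degree_eq_natDegree hpm.ne_zero, degree_eq_natDegree hqm.ne_zero, hpd, hqd]
          rw [← hpd]
          exact natDegree_lt_natDegree hr
            (degree_sub_lt_left hdeg hpm.ne_zero (by rw [hpm, hqm]))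
        have hsmall : polyUnit (p - q) ∈ smallUnits F d := ⟨_, hr, hrd, rfl⟩
        rw [pair_of_eq_add f hij (z := polyUnit (p - q)) (by
          rw [hfp, hfq, val_polyUnit hpm.ne_zero, val_polyUnit hqm.ne_zero, val_polyUnit hr,
            ← map_add]
          ring_nf)]
        exact add_mem (sub_mem (replace_left _ hsmall _ (h1 j hj))
          (replace_left _ hsmall _ (h1 i hi))) (replace_right _ (h1 i hi) _ neg_one_mem)
    · push Not at hs
      refine symbol_comp_perm_mem f (Equiv.swap 0 i) ?_
      obtain ⟨q, hqm, hqi, hqd, hfq⟩ := h1 i hi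
      have hsmall : ∀ k : Fin n, f (Equiv.swap 0 i k.succ) ∈ smallUnits F d := fun k => by
        refine h2 _ fun h => ?_
        have h' := (hs _ h).symm
        rw [Equiv.swap_apply_eq_iff, Equiv.swap_apply_right] at h'
        exact Fin.succ_ne_zero k h'
      choose p hp0 hpd hfp using hsmall
      have hf : f ∘ Equiv.swap 0 i = Fin.cons (polyUnit q) fun k => polyUnit (p k) := by
        ext k
        refine Fin.cases ?_ (fun k => ?_) k
        · simp [hfq]
        · simp [hfp]
      have hcop : ∀ k, IsCoprime (p k) q := fun k =>
        isCoprime_of_degree_lt hqi (hp0 k) (by rw [hqd]; exact hpd k)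
      rw [hf]
      refine ⟨{⟨q, hqm, hqi, hqd⟩}, fun q' hq' => ?_, ?_⟩
      · refine tame_eq_zero q'.2.2.1 (hD _ q'.2.1 q'.2.2.1) _ fun k => ?_
        refine Fin.cases ⟨q, ?_, rfl⟩ (fun k => ⟨p k, ?_, rfl⟩) k
        · exact isCoprime_of_ne q'.2.1 q'.2.2.1 hqm hqi fun h =>
            hq' (Finset.mem_singleton.2 (Subtype.ext h.symm))
        · exact isCoprime_of_degree_lt q'.2.2.1 (hp0 k) (by rw [q'.2.2.2]; exact hpd k)
      · rw [Finset.sum_singleton, tame_cons hqi (hD q hqm hqi) p hcop, prependOf_symbol]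
        congr 3
        ext k
        have hrep : rep q (residueUnit (hcop k) : F[X] ⧸ Ideal.span {q}) = p k :=
          eq_of_mk_eq (degree_rep_lt hqm _) (degree_lt_degree (by rw [hqd]; exact hpd k))
            (mk_rep _)
        simp [hrep]

theorem filtration_le_determined
    (hD : ∀ q : F[X], q.Monic → Irreducible q → IsTameSymbol F n q (D q))
    {d : ℕ} (hd : 1 ≤ d) :
    filtration F (n + 1) (d + 1) ≤ determined D d := by
  rw [filtration, AddSubgroup.closure_le]
  rintro _ ⟨f, hf, rfl⟩
  refine symbol_mem_of_mem_closure f (fun _ => smallUnits F d ∪ primeUnits F d) (fun g hg => ?_)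
    fun i => ?_
  · classical
    refine symbol_mem_determined hD hd {i | g i ∉ smallUnits F d} g (fun i hi => ?_) fun i hi => ?_
    · exact (hg i).resolve_left (by simpa using hi)
    · simpa using hi
  · obtain ⟨p, hp, hpd, hfp⟩ := hf i
    rw [hfp]
    exact polyUnit_mem_closure hd hp hpd

theorem mem_filtration_of_tame_eq_zero
    (hD : ∀ q : F[X], q.Monic → Irreducible q → IsTameSymbol F n q (D q))
    {ζ : MilnorK (RatFunc F) (n + 1)}
    (hζ : ∀ q : F[X], q.Monic → Irreducible q → D q ζ = 0) : ζ ∈ filtration F (n + 1) 1 := by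
  obtain ⟨d, h⟩ := exists_mem_filtration ζ
  induction d with
  | zero => exact h
  | succ d ih =>
    refine ih ?_
    obtain ⟨S, -, hS⟩ := filtration_le_determined hD (Nat.succ_pos d) h
    rw [← QuotientAddGroup.eq_zero_iff, hS]
    exact Finset.sum_eq_zero fun q _ => by rw [hζ q.1 q.2.1 q.2.2.1, map_zero]

theorem tameInf_eq_zero
    (hD : ∀ q : F[X], q.Monic → Irreducible q → IsTameSymbol F n q (D q))
    {Dinf : MilnorK (RatFunc F) (n + 1) →+ MilnorK F n}
    (hDinf : IsTameSymbolInf F n Dinf) {ζ : MilnorK (RatFunc F) (n + 1)}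
    (hζ : ∀ q : F[X], q.Monic → Irreducible q → D q ζ = 0) : Dinf ζ = 0 := by
  suffices filtration F (n + 1) 1 ≤ Dinf.ker from this (mem_filtration_of_tame_eq_zero hD hζ)
  rw [filtration, AddSubgroup.closure_le]
  rintro _ ⟨f, hf, rfl⟩
  choose p hp hpd hfp using hf
  have hC : ∀ i, p i = C ((p i).coeff 0) := fun i =>
    eq_C_of_natDegree_eq_zero (Nat.lt_one_iff.1 (hpd i))
  refine hDinf.2 p (fun i h => hp i ?_) f fun i => ?_
  · rw [hC i, h, C_0]
  · rw [hfp, val_polyUnit (hp i), hC i, aeval_C]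
    rfl

end Exactness

section Avoidance

theorem exists_notMem_of_ne_top {k V : Type*} [Field k] [Infinite k] [AddCommGroup V] [Module k V]
    (s : Finset (Submodule k V)) (hs : ∀ N ∈ s, N ≠ ⊤) : ∃ v, ∀ N ∈ s, v ∉ N := by
  have h := Subspace.biUnion_ne_univ_of_top_notMem (s := s) fun h => hs _ h rfl
  obtain ⟨v, hv⟩ := (Set.ne_univ_iff_exists_notMem _).1 h
  exact ⟨v, fun N hN hvN => hv (Set.mem_biUnion hN hvN)⟩

theorem exists_generic_factor {k : Type*} [Field k] [Infinite k] {π β β' G : k[X]}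
    (hπ : π.Monic) (hd : 1 ≤ π.natDegree) (hβ : π ∣ β * β' - 1) (hG : G ≠ 0) :
    ∃ c : k[X], c.degree < π.natDegree ∧ c.coeff (π.natDegree - 1) ≠ 0 ∧ IsCoprime c G ∧
      ((β * c) %ₘ π).coeff (π.natDegree - 1) ≠ 0 ∧ IsCoprime ((β * c) %ₘ π) G := by
  classical
  set d := π.natDegree with hdef
  have hπdeg : π.degree = d := degree_eq_natDegree hπ.ne_zero
  set Q : k[X] →ₗ[k] k[X] := modByMonicHom π
  let M : k[X] →ₗ[k] k[X] := LinearMap.mulLeft k β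
  have hM : ∀ c, M c = β * c := fun c => rfl
  have hQ : ∀ c, Q c = c %ₘ π := fun c => rfl
  have hQself : ∀ w : k[X], w.degree < d → Q w = w := fun w hw =>
    (modByMonic_eq_self_iff hπ).2 (by rwa [hπdeg])
  have hQdvd : ∀ w : k[X], π ∣ w → Q w = 0 := fun w hw => (modByMonic_eq_zero_iff_dvd hπ).2 hw
  have hQM : ∀ w : k[X], w.degree < d → Q (M (β' * w)) = w := fun w hw => by
    have : β * (β' * w) = w + (β * β' - 1) * w := by ring
    rw [hM, this, map_add, hQself w hw, hQdvd _ (hβ.mul_right w), add_zero]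
  have hQMQ : ∀ c, Q (M (Q c)) = Q (M c) := fun c => by
    have h := modByMonic_add_div c π
    have : β * c = β * (c %ₘ π) + π * (β * (c /ₘ π)) := by linear_combination -β * h
    rw [hM, hM, this, map_add, hQdvd _ (dvd_mul_right _ _), add_zero, hQ c]
  let S : Finset (Submodule k k[X]) := insert (LinearMap.ker (lcoeff k (d - 1)))
    ((UniqueFactorizationMonoid.normalizedFactors G).toFinset.image fun p =>
      (Ideal.span {p}).restrictScalars k)
  have hS : ∀ N ∈ S, ∃ w : k[X], w.degree < d ∧ w ∉ N := by
    intro N hN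
    rcases Finset.mem_insert.1 hN with rfl | hN
    · refine ⟨X ^ (d - 1), ?_, by simp⟩
      rw [degree_X_pow]
      exact_mod_cast Nat.sub_lt hd one_pos
    · obtain ⟨p, hp, rfl⟩ := Finset.mem_image.1 hN
      refine ⟨1, ?_, fun h => ?_⟩
      · rw [degree_one]
        exact_mod_cast hd
      · rw [Submodule.restrictScalars_mem, Ideal.mem_span_singleton] at h
        exact (UniqueFactorizationMonoid.irreducible_of_normalized_factor p
          (Multiset.mem_toFinset.1 hp)).not_isUnit (isUnit_of_dvd_one h)
  obtain ⟨c, hc⟩ := exists_notMem_of_ne_top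
    (S.image (fun N => N.comap Q) ∪ S.image (fun N => N.comap (Q ∘ₗ M))) (by
      intro N hN htop
      rcases Finset.mem_union.1 hN with hN | hN <;>
        obtain ⟨N', hN', rfl⟩ := Finset.mem_image.1 hN <;>
        obtain ⟨w, hw, hwN⟩ := hS N' hN'
      · have : w ∈ N'.comap Q := htop ▸ Submodule.mem_top
        rw [Submodule.mem_comap, hQself w hw] at this
        exact hwN this
      · have : β' * w ∈ N'.comap (Q ∘ₗ M) := htop ▸ Submodule.mem_top
        rw [Submodule.mem_comap, LinearMap.comp_apply, hQM w hw] at this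
        exact hwN this)
  have h1 : ∀ N ∈ S, Q c ∉ N := fun N hN =>
    hc _ (Finset.mem_union_left _ (Finset.mem_image_of_mem _ hN))
  have h2 : ∀ N ∈ S, Q (M (Q c)) ∉ N := fun N hN => by
    rw [hQMQ]
    exact hc _ (Finset.mem_union_right _ (Finset.mem_image_of_mem _ hN))
  have hcoeff : ∀ x : k[X], (∀ N ∈ S, x ∉ N) → x.coeff (d - 1) ≠ 0 := fun x hx => by
    simpa using hx _ (Finset.mem_insert_self _ _)
  have hcop : ∀ x : k[X], (∀ N ∈ S, x ∉ N) → IsCoprime x G := fun x hx => by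
    refine isCoprime_of_irreducible_dvd (fun h => hG h.2) fun z hz hzx hzG => ?_
    obtain ⟨p, hp, hzp⟩ := UniqueFactorizationMonoid.exists_mem_normalizedFactors_of_dvd hG hz hzG
    refine hx _ (Finset.mem_insert_of_mem (Finset.mem_image_of_mem _
      (Multiset.mem_toFinset.2 hp))) ?_
    rw [Submodule.restrictScalars_mem, Ideal.mem_span_singleton]
    exact hzp.symm.dvd.trans hzx
  refine ⟨Q c, ?_, hcoeff _ h1, hcop _ h1, hcoeff _ h2, hcop _ h2⟩
  rw [← hπdeg]
  exact degree_modByMonic_lt c hπ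

end Avoidance

section Semilocal

variable {A : Type*} [CommRing A]

theorem exists_polynomial_lift (hfin : {I : Ideal A | I.IsMaximal}.Finite) (d : ℕ)
    (c : ∀ m : {I : Ideal A // I.IsMaximal}, (A ⧸ m.1)[X]) (hc : ∀ m, (c m).degree < d) :
    ∃ g : A[X], g.degree < d ∧ ∀ m, g.map (Ideal.Quotient.mk m.1) = c m := by
  have : Finite {I : Ideal A // I.IsMaximal} := hfin
  have hcop : Pairwise (onFun IsCoprime fun m : {I : Ideal A // I.IsMaximal} => m.1) :=
    fun m m' h => by
      have := m.2
      have := m'.2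
      exact Ideal.isCoprime_of_isMaximal fun h' => h (Subtype.ext h')
  have hcrt : ∀ i, ∃ a : A, ∀ m : {I : Ideal A // I.IsMaximal},
      Ideal.Quotient.mk m.1 a = (c m).coeff i := fun i => by
    obtain ⟨x, hx⟩ := Ideal.quotientInfToPiQuotient_surj hcop fun m => (c m).coeff i
    obtain ⟨a, rfl⟩ := Ideal.Quotient.mk_surjective x
    exact ⟨a, fun m => congrFun hx m⟩
  choose a ha using hcrt
  have hcoeff : ∀ i, (∑ j ∈ Finset.range d, monomial j (a j)).coeff i = if i < d then a i else 0 :=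
    fun i => by simp [coeff_monomial]
  refine ⟨∑ j ∈ Finset.range d, monomial j (a j), ?_, fun m => ?_⟩
  · rw [degree_lt_iff_coeff_zero]
    intro i hi
    rw [hcoeff, if_neg hi.not_gt]
  · ext i
    rw [coeff_map, hcoeff]
    split_ifs with h
    · exact ha i m
    · rw [map_zero, (degree_lt_iff_coeff_zero _ _).1 (hc m) i (not_lt.1 h)]

theorem isUnit_of_forall_notMem {a : A} (h : ∀ m : Ideal A, m.IsMaximal → a ∉ m) : IsUnit a := by
  by_contra hu
  obtain ⟨m, hm, ham⟩ := exists_max_ideal_of_mem_nonunits hu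
  exact h m hm ham

theorem finite_quotient_of_isUnit_leadingCoeff {G : A[X]} (hG : IsUnit G.leadingCoeff) :
    Module.Finite A (A[X] ⧸ Ideal.span {G}) := by
  obtain ⟨u, hu⟩ := hG
  have hmonic : (C (↑u⁻¹ : A) * G).Monic :=
    monic_C_mul_of_mul_leadingCoeff_eq_one (by rw [← hu, Units.inv_mul])
  rw [← Ideal.span_singleton_mul_left_unit (isUnit_C.2 u⁻¹.isUnit) G]
  exact hmonic.finite_quotient

theorem isCoprime_of_forall_residue {c G : A[X]} (hG : IsUnit G.leadingCoeff)
    (h : ∀ m : Ideal A, m.IsMaximal →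
      IsCoprime (c.map (Ideal.Quotient.mk m)) (G.map (Ideal.Quotient.mk m))) :
    IsCoprime c G := by
  have := finite_quotient_of_isUnit_leadingCoeff hG
  set B := A[X] ⧸ Ideal.span {G}
  have hc : IsUnit (Ideal.Quotient.mk (Ideal.span {G}) c) := by
    refine isUnit_of_forall_notMem fun M hM hcM => ?_
    have hm := Ideal.isMaximal_comap_of_isIntegral_of_isMaximal (R := A) M
    set m := M.comap (algebraMap A B)
    let φ : A[X] →+* B ⧸ M := (Ideal.Quotient.mk M).comp (Ideal.Quotient.mk (Ideal.span {G}))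
    let ψ : (A ⧸ m)[X] →+* B ⧸ M := eval₂RingHom
      (Ideal.Quotient.lift m ((Ideal.Quotient.mk M).comp (algebraMap A B)) fun a ha =>
        Ideal.Quotient.eq_zero_iff_mem.2 ha) (φ X)
    have hψ : ∀ f : A[X], ψ (f.map (Ideal.Quotient.mk m)) = φ f := fun f => by
      have : ψ.comp (mapRingHom (Ideal.Quotient.mk m)) = φ := by
        refine ringHom_ext (fun a => ?_) ?_
        · simp [ψ, φ]
          rfl
        · simp [ψ]
      rw [← this]
      rfl
    obtain ⟨x, y, hxy⟩ := h m hm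
    have h1 := congrArg ψ hxy
    have hφc : φ c = 0 := Ideal.Quotient.eq_zero_iff_mem.2 hcM
    have hφG : φ G = 0 := by
      have : Ideal.Quotient.mk (Ideal.span {G}) G = 0 :=
        Ideal.Quotient.eq_zero_iff_mem.2 (Ideal.mem_span_singleton_self G)
      simp [φ, this]
    rw [map_add, map_mul, map_mul, hψ, hψ, hφc, hφG, map_one, mul_zero, mul_zero, add_zero] at h1
    exact zero_ne_one h1
  obtain ⟨y, hy⟩ := hc.exists_right_inv
  obtain ⟨y, rfl⟩ := Ideal.Quotient.mk_surjective y
  rw [← map_mul, ← map_one (Ideal.Quotient.mk (Ideal.span {G})), Ideal.Quotient.eq,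
    Ideal.mem_span_singleton] at hy
  obtain ⟨z, hz⟩ := hy
  exact ⟨y, -z, by linear_combination hz⟩

variable [IsDomain A]

theorem isUnit_leadingCoeff_of_coeff {c : A[X]} {d : ℕ} (hd : 1 ≤ d) (hc : c.degree < d)
    (hu : IsUnit (c.coeff (d - 1))) : IsUnit c.leadingCoeff ∧ c.natDegree < d := by
  have hc0 : c ≠ 0 := by rintro rfl; simp at hu
  have h1 : c.natDegree < d := (natDegree_lt_iff_degree_lt hc0).2 hc
  have h2 : d - 1 ≤ c.natDegree := le_natDegree_of_ne_zero hu.ne_zero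
  rw [leadingCoeff, show c.natDegree = d - 1 by omega]
  exact ⟨hu, by omega⟩

theorem exists_generic_quotient (hfin : {I : Ideal A | I.IsMaximal}.Finite)
    (hres : ∀ I : Ideal A, I.IsMaximal → Infinite (A ⧸ I)) {π G : A[X]} (hπ : π.Monic)
    (hd : 1 ≤ π.natDegree) (hG : IsUnit G.leadingCoeff) (b : (A[X] ⧸ Ideal.span {π})ˣ) :
    ∃ c c' : A[X], (IsUnit c.leadingCoeff ∧ c.natDegree < π.natDegree) ∧
      (IsUnit c'.leadingCoeff ∧ c'.natDegree < π.natDegree) ∧ IsCoprime c G ∧ IsCoprime c' G ∧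
      Ideal.Quotient.mk (Ideal.span {π}) c = b * Ideal.Quotient.mk (Ideal.span {π}) c' := by
  obtain ⟨β, hβ⟩ := Ideal.Quotient.mk_surjective (b : A[X] ⧸ Ideal.span {π})
  obtain ⟨β', hβ'⟩ := Ideal.Quotient.mk_surjective ((b⁻¹ : (A[X] ⧸ Ideal.span {π})ˣ) :
    A[X] ⧸ Ideal.span {π})
  have hββ' : π ∣ β * β' - 1 := by
    rw [← Ideal.mem_span_singleton, ← Ideal.Quotient.eq, map_mul, hβ, hβ', map_one, Units.mul_inv]
  have hlocal : ∀ m : {I : Ideal A // I.IsMaximal}, ∃ c : (A ⧸ m.1)[X],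
      c.degree < π.natDegree ∧ c.coeff (π.natDegree - 1) ≠ 0 ∧
      IsCoprime c (G.map (Ideal.Quotient.mk m.1)) ∧
      ((β.map (Ideal.Quotient.mk m.1) * c) %ₘ π.map (Ideal.Quotient.mk m.1)).coeff
        (π.natDegree - 1) ≠ 0 ∧
      IsCoprime ((β.map (Ideal.Quotient.mk m.1) * c) %ₘ π.map (Ideal.Quotient.mk m.1))
        (G.map (Ideal.Quotient.mk m.1)) := fun ⟨m, hm⟩ => by
    have := hres m hm
    let := Ideal.Quotient.field m
    have hdeg : (π.map (Ideal.Quotient.mk m)).natDegree = π.natDegree := hπ.natDegree_map _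
    have hG0 : G.map (Ideal.Quotient.mk m) ≠ 0 := fun h => by
      have h' := congrArg (fun p => p.coeff G.natDegree) h
      rw [coeff_map, coeff_zero] at h'
      exact (hG.map (Ideal.Quotient.mk m)).ne_zero h'
    have hdvd : π.map (Ideal.Quotient.mk m) ∣
        β.map (Ideal.Quotient.mk m) * β'.map (Ideal.Quotient.mk m) - 1 := by
      simpa using Polynomial.map_dvd (Ideal.Quotient.mk m) hββ'
    have h := exists_generic_factor (hπ.map (Ideal.Quotient.mk m)) (by rwa [hdeg]) hdvd hG0
    rwa [hdeg] at h
  choose c hc1 hc2 hc3 hc4 hc5 using hlocal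
  obtain ⟨g, hgd, hg⟩ := exists_polynomial_lift hfin π.natDegree c hc1
  have hmap : ∀ m : {I : Ideal A // I.IsMaximal}, ((β * g) %ₘ π).map (Ideal.Quotient.mk m.1) =
      (β.map (Ideal.Quotient.mk m.1) * c m) %ₘ π.map (Ideal.Quotient.mk m.1) := fun m => by
    rw [map_modByMonic _ hπ, Polynomial.map_mul, hg]
  have hunit : ∀ (x : A[X]) (i : ℕ), (∀ m : {I : Ideal A // I.IsMaximal},
      (x.map (Ideal.Quotient.mk m.1)).coeff i ≠ 0) → IsUnit (x.coeff i) := fun x i h => by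
    refine isUnit_of_forall_notMem fun m hm hmem => h ⟨m, hm⟩ ?_
    rw [coeff_map]
    exact Ideal.Quotient.eq_zero_iff_mem.2 hmem
  refine ⟨(β * g) %ₘ π, g, isUnit_leadingCoeff_of_coeff hd ?_ (hunit _ _ fun m => ?_),
    isUnit_leadingCoeff_of_coeff hd hgd (hunit _ _ fun m => ?_),
    isCoprime_of_forall_residue hG fun m hm => ?_,
    isCoprime_of_forall_residue hG fun m hm => ?_, ?_⟩
  · rw [← degree_eq_natDegree hπ.ne_zero]
    exact degree_modByMonic_lt _ hπ
  · rw [hmap]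
    exact hc4 m
  · rw [hg]
    exact hc2 m
  · rw [hmap ⟨m, hm⟩]
    exact hc5 ⟨m, hm⟩
  · rw [hg ⟨m, hm⟩]
    exact hc3 ⟨m, hm⟩
  · rw [← hβ, ← map_mul, Ideal.Quotient.eq, Ideal.mem_span_singleton]
    exact ⟨-((β * g) /ₘ π), by linear_combination modByMonic_add_div (β * g) π⟩

/-- Polynomials of degree less than `d` that are unit constants or monic irreducible. -/
def IsElementary (d : ℕ) (g : A[X]) : Prop :=
  IsUnit g.leadingCoeff ∧ g.natDegree < d ∧ (g.natDegree = 0 ∨ g.Monic ∧ Irreducible g)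

theorem mem_closure_elementary [UniqueFactorizationMonoid A] {π : A[X]} (H : A[X]) (c : A[X])
    (hlc : IsUnit c.leadingCoeff) (hdeg : c.natDegree < π.natDegree) (hH : IsCoprime c H)
    (hπ : IsCoprime c π) :
    residueUnit hπ ∈ Subgroup.closure {x : (A[X] ⧸ Ideal.span {π})ˣ |
      ∃ g : A[X], IsElementary π.natDegree g ∧ IsCoprime g H ∧ IsCoprime g π ∧
        (x : A[X] ⧸ Ideal.span {π}) = Ideal.Quotient.mk (Ideal.span {π}) g} := by
  induction c using WfDvdMonoid.induction_on_irreducible with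
  | zero => simp at hlc
  | unit u hu =>
    exact Subgroup.subset_closure ⟨u, ⟨hlc, hdeg, Or.inl (natDegree_eq_zero_of_isUnit hu)⟩, hH, hπ,
      rfl⟩
  | mul a i ha hi ih =>
    rw [leadingCoeff_mul] at hlc
    obtain ⟨u, hu⟩ := isUnit_of_mul_isUnit_left hlc
    have hla := isUnit_of_mul_isUnit_right hlc
    have hdm := natDegree_mul hi.ne_zero ha
    have hCu : IsUnit (C (u : A)) := isUnit_C.2 u.isUnit
    have hCu' : IsUnit (C (↑u⁻¹ : A)) := isUnit_C.2 u⁻¹.isUnit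
    have hmonic : (C (↑u⁻¹ : A) * i).Monic :=
      monic_C_mul_of_mul_leadingCoeff_eq_one (by rw [← hu, Units.inv_mul])
    have hirr : Irreducible (C (↑u⁻¹ : A) * i) := (irreducible_isUnit_mul hCu').2 hi
    have hdi : (C (↑u⁻¹ : A) * i).natDegree = i.natDegree :=
      natDegree_C_mul u⁻¹.ne_zero
    have hiH : IsCoprime (C (↑u⁻¹ : A) * i) H :=
      (isCoprime_mul_unit_left_left hCu' _ _).2 hH.of_mul_left_left
    have hiπ : IsCoprime (C (↑u⁻¹ : A) * i) π :=
      (isCoprime_mul_unit_left_left hCu' _ _).2 hπ.of_mul_left_left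
    have huH : ∀ p : A[X], IsCoprime (C (u : A)) p := fun p =>
      isCoprime_one_left.of_isCoprime_of_dvd_left hCu.dvd
    have heq : residueUnit hπ = residueUnit (huH π) * residueUnit hiπ *
        residueUnit hπ.of_mul_left_right := by
      ext
      simp only [Units.val_mul, val_residueUnit, ← map_mul]
      rw [← mul_assoc (C (u : A)), ← C_mul, Units.mul_inv, C_1, one_mul]
    rw [heq]
    refine mul_mem (mul_mem (Subgroup.subset_closure ⟨C (u : A), ⟨by simp, ?_, Or.inl (by simp)⟩,
      huH H, huH π, rfl⟩) (Subgroup.subset_closure ⟨C (↑u⁻¹ : A) * i,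
        ⟨by rw [hmonic]; exact isUnit_one, by omega, Or.inr ⟨hmonic, hirr⟩⟩, hiH, hiπ, rfl⟩))
      (ih hla (by omega) hH.of_mul_left_right hπ.of_mul_left_right)
    rw [natDegree_C]
    omega

theorem unit_mem_closure_elementary [UniqueFactorizationMonoid A]
    (hfin : {I : Ideal A | I.IsMaximal}.Finite)
    (hres : ∀ I : Ideal A, I.IsMaximal → Infinite (A ⧸ I)) {π G : A[X]} (hπ : π.Monic)
    (hd : 1 ≤ π.natDegree) (hG : IsUnit G.leadingCoeff) (b : (A[X] ⧸ Ideal.span {π})ˣ) :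
    b ∈ Subgroup.closure {x : (A[X] ⧸ Ideal.span {π})ˣ |
      ∃ g : A[X], IsElementary π.natDegree g ∧ IsCoprime g G ∧ IsCoprime g π ∧
        (x : A[X] ⧸ Ideal.span {π}) = Ideal.Quotient.mk (Ideal.span {π}) g} := by
  obtain ⟨c, c', h, h', hc, hc', heq⟩ := exists_generic_quotient hfin hres hπ hd
    (G := G * π) (by rwa [leadingCoeff_mul, hπ, mul_one]) b
  have : b = residueUnit hc.of_mul_right_right / residueUnit hc'.of_mul_right_right := by
    rw [eq_div_iff_mul_eq']
    ext
    rw [Units.val_mul, val_residueUnit, val_residueUnit, heq, mul_comm]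
  rw [this]
  exact div_mem
    (mem_closure_elementary G c h.1 h.2 hc.of_mul_right_left hc.of_mul_right_right)
    (mem_closure_elementary G c' h'.1 h'.2 hc'.of_mul_right_left hc'.of_mul_right_right)

/-- `K_n(A[t]/(π))` is generated by symbols of pairwise comaximal elementary polynomials. -/
theorem mem_of_elementary_symbol_mem [UniqueFactorizationMonoid A]
    (hfin : {I : Ideal A | I.IsMaximal}.Finite)
    (hres : ∀ I : Ideal A, I.IsMaximal → Infinite (A ⧸ I)) {n : ℕ} {π : A[X]} (hπ : π.Monic)
    (hd : 1 ≤ π.natDegree) {H : AddSubgroup (MilnorK (A[X] ⧸ Ideal.span {π}) n)}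
    (hH : ∀ g : Fin n → A[X], (∀ i, IsElementary π.natDegree (g i)) →
      (∀ i j, i ≠ j → IsCoprime (g i) (g j)) → ∀ hgπ : ∀ i, IsCoprime (g i) π,
      MilnorSymbol (fun i => residueUnit (hgπ i)) ∈ H)
    (x : MilnorK (A[X] ⧸ Ideal.span {π}) n) : x ∈ H := by
  refine mem_of_symbol_mem (fun f => ?_) x
  suffices key : ∀ (s : Finset (Fin n)) (f : Fin n → (A[X] ⧸ Ideal.span {π})ˣ) (g : Fin n → A[X]),
      (∀ i ∉ s, IsElementary π.natDegree (g i) ∧ IsCoprime (g i) π ∧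
        (f i : A[X] ⧸ Ideal.span {π}) = Ideal.Quotient.mk (Ideal.span {π}) (g i)) →
      (∀ i ∉ s, ∀ j ∉ s, i ≠ j → IsCoprime (g i) (g j)) → MilnorSymbol f ∈ H from
    key Finset.univ f (fun _ => 0) (by simp) (by simp)
  intro s
  induction s using Finset.induction_on with
  | empty =>
    intro f g h1 h2
    simp only [Finset.notMem_empty, not_false_eq_true, forall_const] at h1 h2
    have := hH g (fun i => (h1 i).1) h2 fun i => (h1 i).2.1
    convert this using 2
    ext i
    exact (h1 i).2.2
  | insert i s hi ih =>
    intro f g h1 h2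
    have hG : IsUnit (∏ j ∈ (insert i s)ᶜ, g j).leadingCoeff := by
      rw [leadingCoeff_prod]
      exact Finset.prod_induction _ IsUnit (fun _ _ => IsUnit.mul) isUnit_one fun j hj =>
        (h1 j (Finset.mem_compl.1 hj)).1.1
    suffices ∀ x, MilnorSymbol (update f i x) ∈ H by simpa using this (f i)
    intro x
    have hx := unit_mem_closure_elementary hfin hres hπ hd hG x
    induction hx using Subgroup.closure_induction with
    | mem x hx =>
      obtain ⟨p, hp, hpG, hpπ, hxp⟩ := hx
      have hpg : ∀ j ∉ s, j ≠ i → IsCoprime p (g j) := fun j hj hji =>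
        hpG.of_isCoprime_of_dvd_right (Finset.dvd_prod_of_mem g (by simp [hj, hji]))
      refine ih _ (update g i p) (fun j hj => ?_) fun j hj k hk hjk => ?_
      · by_cases hji : j = i
        · subst hji
          simpa using ⟨hp, hpπ, hxp⟩
        · simpa [update_of_ne hji] using h1 j (by simp [hj, hji])
      · by_cases hji : j = i
        · subst hji
          simpa [update_of_ne hjk.symm] using hpg k hk hjk.symm
        · by_cases hki : k = i
          · subst hki
            simpa [update_of_ne hji] using (hpg j hj hji).symm
          · simpa [update_of_ne hji, update_of_ne hki] using
              h2 j (by simp [hj, hji]) k (by simp [hk, hki]) hjk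
    | one => simp [symbol_update_one]
    | mul x y _ _ hx hy => rw [symbol_update_mul]; exact add_mem hx hy
    | inv x _ hx => rw [symbol_update_inv]; exact neg_mem hx

end Semilocal

section Infinity

variable (A : Type*) {K : Type*} [CommRing A] [Field K] [Algebra A K] {n : ℕ}

/-- The units of `K(t)` of the form `p(1/t)` with `p(0) ∈ Aˣ`. -/
def infUnits (K : Type*) [Field K] [Algebra A K] : Set (RatFunc K)ˣ :=
  {u | ∃ p : K[X], (∃ a : Aˣ, p.coeff 0 = algebraMap A K a) ∧
    (u : RatFunc K) = aeval (RatFunc.X)⁻¹ p}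

/-- The uniformizer `1/t` at infinity. -/
noncomputable def infUniformizer (K : Type*) [Field K] : (RatFunc K)ˣ :=
  Units.mk0 (RatFunc.X)⁻¹ (inv_ne_zero RatFunc.X_ne_zero)

variable {A}

theorem tameInf_symbol_mem_range {Dinf : MilnorK (RatFunc K) (n + 1) →+ MilnorK K n}
    (hDinf : IsTameSymbolInf K n Dinf) (s : Finset (Fin (n + 1)))
    (f : Fin (n + 1) → (RatFunc K)ˣ) (h1 : ∀ i ∈ s, f i = infUniformizer K)
    (h2 : ∀ i ∉ s, f i ∈ infUnits A K) :
    MilnorSymbol f ∈ (map (algebraMap A K)).range.comap Dinf := by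
  have coeff_ne_zero : ∀ {p : K[X]} {a : Aˣ}, p.coeff 0 = algebraMap A K a → p.coeff 0 ≠ 0 :=
    fun {p a} h => by
      rw [h]
      exact (a.isUnit.map (algebraMap A K)).ne_zero
  induction s using Finset.strongInduction generalizing f with
  | H s ih =>
    rcases s.eq_empty_or_nonempty with rfl | ⟨i, hi⟩
    · choose p hp hfp using fun i => h2 i (Finset.notMem_empty i)
      choose a ha using hp
      rw [AddSubgroup.mem_comap, hDinf.2 p (fun i => coeff_ne_zero (ha i)) f hfp]
      exact zero_mem _
    by_cases hs : ∃ j ∈ s, i ≠ j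
    · obtain ⟨j, hj, hij⟩ := hs
      rw [← pair_self f i j, h1 i hi, h1 j hj, pair_same f hij]
      refine ih (s.erase j) (Finset.erase_ssubset hj) _ (fun k hk => ?_) fun k hk => ?_
      · obtain ⟨hkj, hks⟩ := Finset.mem_erase.1 hk
        by_cases hki : k = i
        · subst hki; simp [update_of_ne hij]
        · simpa [update_of_ne hkj, update_of_ne hki] using h1 k hks
      · by_cases hkj : k = j
        · subst hkj
          exact ⟨-1, ⟨-1, by simp⟩, by simp⟩
        · have hks : k ∉ s := fun h => hk (Finset.mem_erase.2 ⟨hkj, h⟩)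
          have hki : k ≠ i := fun h => hks (h ▸ hi)
          simpa [update_of_ne hkj, update_of_ne hki] using h2 k hks
    · push Not at hs
      refine symbol_comp_perm_mem f (Equiv.swap 0 i) ?_
      have hinf : ∀ k : Fin n, f (Equiv.swap 0 i k.succ) ∈ infUnits A K := fun k => by
        refine h2 _ fun h => ?_
        have h' := (hs _ h).symm
        rw [Equiv.swap_apply_eq_iff, Equiv.swap_apply_right] at h'
        exact Fin.succ_ne_zero k h'
      choose p hp hfp using hinf
      choose a ha using hp
      refine ⟨MilnorSymbol a, ?_⟩
      rw [map_symbol]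
      refine (hDinf.1 p (fun i => coeff_ne_zero (ha i)) _ _ ?_ hfp fun k => (ha k).symm).symm
      simp [h1 i hi, infUniformizer]

theorem aeval_inv_reverse_mul_pow (p : K[X]) :
    aeval (RatFunc.X)⁻¹ p.reverse * RatFunc.X ^ p.natDegree =
      algebraMap K[X] (RatFunc K) p := by
  let : Invertible (RatFunc.X : RatFunc K) := invertibleOfNonzero RatFunc.X_ne_zero
  have h := eval₂_reverse_mul_pow (algebraMap K (RatFunc K)) RatFunc.X p
  rw [invOf_eq_inv] at h
  rw [aeval_def, h, ← aeval_def, RatFunc.aeval_X_left_eq_algebraMap]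

theorem polyUnit_mem_closure_inf {g : A[X]} (hg : IsUnit g.leadingCoeff) :
    polyUnit (g.map (algebraMap A K)) ∈
      Subgroup.closure ({infUniformizer K} ∪ infUnits A K) := by
  have hlc : algebraMap A K g.leadingCoeff ≠ 0 := (hg.map _).ne_zero
  have hmap : (g.map (algebraMap A K)).leadingCoeff = algebraMap A K g.leadingCoeff :=
    leadingCoeff_map_of_leadingCoeff_ne_zero _ hlc
  have hg0 : g.map (algebraMap A K) ≠ 0 := leadingCoeff_ne_zero.1 (hmap ▸ hlc)
  generalize g.map (algebraMap A K) = p at *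
  have hmem : polyUnit p * infUniformizer K ^ p.natDegree ∈ infUnits A K := by
    refine ⟨p.reverse, ⟨hg.unit, by rw [coeff_zero_reverse, hmap, IsUnit.unit_spec]⟩, ?_⟩
    rw [Units.val_mul, Units.val_pow_eq_pow_val, val_polyUnit hg0, infUniformizer, Units.val_mk0,
      ← aeval_inv_reverse_mul_pow, inv_pow, mul_assoc,
      mul_inv_cancel₀ (pow_ne_zero _ RatFunc.X_ne_zero), mul_one]
  have hunif : infUniformizer K ∈ Subgroup.closure ({infUniformizer K} ∪ infUnits A K) :=
    Subgroup.subset_closure (Set.mem_union_left _ (Set.mem_singleton _))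
  exact (Subgroup.mul_mem_cancel_right _ (pow_mem hunif _)).1
    (Subgroup.subset_closure (Set.mem_union_right _ hmem))

theorem tameInf_polyUnit_mem_range {Dinf : MilnorK (RatFunc K) (n + 1) →+ MilnorK K n}
    (hDinf : IsTameSymbolInf K n Dinf) {f : Fin (n + 1) → (RatFunc K)ˣ}
    (hf : ∀ i, ∃ g : A[X], IsUnit g.leadingCoeff ∧ f i = polyUnit (g.map (algebraMap A K))) :
    Dinf (MilnorSymbol f) ∈ (map (algebraMap A K)).range := by
  refine symbol_mem_of_mem_closure (H := (map (algebraMap A K)).range.comap Dinf) f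
    (fun _ => {infUniformizer K} ∪ infUnits A K) (fun u hu => ?_) fun i => ?_
  · classical
    refine tameInf_symbol_mem_range hDinf {i | u i = infUniformizer K} u (fun i hi => ?_)
      fun i hi => ?_
    · simpa using hi
    · exact (hu i).resolve_left (by simpa using hi)
  · obtain ⟨g, hg, h⟩ := hf i
    rw [h]
    exact polyUnit_mem_closure_inf hg

end Infinity

section Existence

variable {A : Type*} (K : Type*) [CommRing A] [Field K] [Algebra A K] {n : ℕ}

/-- The base change `A[t]/(π) → K[t]/(π)`. -/
noncomputable def quotMap (π : A[X]) :
    (A[X] ⧸ Ideal.span {π}) →+* (K[X] ⧸ Ideal.span {π.map (algebraMap A K)}) :=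
  Ideal.quotientMap _ (mapRingHom (algebraMap A K)) <| by
    rw [Ideal.span_le, Set.singleton_subset_iff]
    exact Ideal.subset_span rfl

theorem quotMap_mk (π g : A[X]) : quotMap K π (Ideal.Quotient.mk _ g) =
    Ideal.Quotient.mk _ (g.map (algebraMap A K)) := rfl

variable {K}

theorem isCoprime_map {g π : A[X]} (h : IsCoprime g π) :
    IsCoprime (g.map (algebraMap A K)) (π.map (algebraMap A K)) :=
  h.map (mapRingHom (algebraMap A K))

theorem map_quotMap_residueUnit {π : A[X]} {g : Fin n → A[X]} (h : ∀ i, IsCoprime (g i) π) :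
    map (quotMap K π) (MilnorSymbol fun i => residueUnit (h i)) =
      MilnorSymbol fun i => residueUnit (isCoprime_map (K := K) (h i)) := by
  rw [map_symbol]
  congr 1
  ext i
  rfl

theorem tame_cons_eq_map {π : A[X]} (hirr : Irreducible (π.map (algebraMap A K)))
    {D : MilnorK (RatFunc K) (n + 1) →+ MilnorK (K[X] ⧸ Ideal.span {π.map (algebraMap A K)}) n}
    (hD : IsTameSymbol K n (π.map (algebraMap A K)) D) {g : Fin n → A[X]}
    (h : ∀ i, IsCoprime (g i) π) :
    D (MilnorSymbol (Fin.cons (polyUnit (π.map (algebraMap A K)))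
      fun i => polyUnit ((g i).map (algebraMap A K)))) =
      map (quotMap K π) (MilnorSymbol fun i => residueUnit (h i)) := by
  rw [tame_cons hirr hD _ fun i => isCoprime_map (h i), map_quotMap_residueUnit]

/-- If one entry of a symbol is `p` and the others are coprime to `p`, its tame symbol at `p` is
defined over the base ring. -/
theorem tame_mem_range {p : A[X]} (hirr : Irreducible (p.map (algebraMap A K)))
    {D : MilnorK (RatFunc K) (n + 1) →+ MilnorK (K[X] ⧸ Ideal.span {p.map (algebraMap A K)}) n}
    (hD : IsTameSymbol K n (p.map (algebraMap A K)) D) {g : Fin (n + 1) → A[X]}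
    (i : Fin (n + 1)) (hi : g i = p) (h : ∀ j, j ≠ i → IsCoprime (g j) p) :
    D (MilnorSymbol fun j => polyUnit ((g j).map (algebraMap A K))) ∈
      (map (quotMap K p)).range := by
  refine symbol_comp_perm_mem (H := (map (quotMap K p)).range.comap D) _ (Equiv.swap 0 i) ?_
  have hcop : ∀ k : Fin n, IsCoprime (g (Equiv.swap 0 i k.succ)) p := fun k => h _ fun hk => by
    rw [Equiv.swap_apply_eq_iff, Equiv.swap_apply_right] at hk
    exact Fin.succ_ne_zero k hk
  refine ⟨_, (tame_cons_eq_map hirr hD hcop).symm.trans (congrArg (fun u => D (MilnorSymbol u)) ?_)⟩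
  ext k
  refine Fin.cases ?_ (fun k => ?_) k <;> simp [hi]

variable [IsFractionRing A K] [IsDomain A] [UniqueFactorizationMonoid A]

theorem exists_tame_eq
    (hfin : {I : Ideal A | I.IsMaximal}.Finite)
    (hres : ∀ I : Ideal A, I.IsMaximal → Infinite (A ⧸ I))
    {D : ∀ q : K[X], MilnorK (RatFunc K) (n + 1) →+ MilnorK (K[X] ⧸ Ideal.span {q}) n}
    (hD : ∀ q : K[X], q.Monic → Irreducible q → IsTameSymbol K n q (D q))
    {Dinf : MilnorK (RatFunc K) (n + 1) →+ MilnorK K n} (hDinf : IsTameSymbolInf K n Dinf)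
    {π : A[X]} (hπ : π.Monic) (hirr : Irreducible π) (ξ : MilnorK (A[X] ⧸ Ideal.span {π}) n) :
    ∃ ζ : MilnorK (RatFunc K) (n + 1),
      D (π.map (algebraMap A K)) ζ = map (quotMap K π) ξ ∧
      (∀ q : K[X], q.Monic → Irreducible q → q ≠ π.map (algebraMap A K) → D q ζ = 0) ∧
      Dinf ζ ∈ (map (algebraMap A K)).range := by
  induction hd : π.natDegree using Nat.strong_induction_on generalizing π with
  | _ d ih =>
  have hirrK : ∀ {p : A[X]}, p.Monic → Irreducible p → Irreducible (p.map (algebraMap A K)) :=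
    fun hp h => (Monic.irreducible_iff_irreducible_map_fraction_map hp).1 h
  have inj : Injective (Polynomial.map (algebraMap A K)) :=
    map_injective _ (IsFractionRing.injective A K)
  let H : AddSubgroup (MilnorK (A[X] ⧸ Ideal.span {π}) n) :=
    { carrier := {ξ | ∃ ζ : MilnorK (RatFunc K) (n + 1),
        D (π.map (algebraMap A K)) ζ = map (quotMap K π) ξ ∧
        (∀ q : K[X], q.Monic → Irreducible q → q ≠ π.map (algebraMap A K) → D q ζ = 0) ∧
        Dinf ζ ∈ (map (algebraMap A K)).range}
      zero_mem' := ⟨0, by simp, by simp, by rw [map_zero]; exact zero_mem _⟩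
      neg_mem' := by
        rintro ξ ⟨ζ, h1, h2, h3⟩
        exact ⟨-ζ, by simp [h1], fun q hq hi h => by simp [h2 q hq hi h],
          by rw [map_neg]; exact neg_mem h3⟩
      add_mem' := by
        rintro ξ ξ' ⟨ζ, h1, h2, h3⟩ ⟨ζ', h1', h2', h3'⟩
        exact ⟨ζ + ζ', by simp [h1, h1'], fun q hq hi h => by simp [h2 q hq hi h, h2' q hq hi h],
          by rw [map_add]; exact add_mem h3 h3'⟩ }
  have hd1 : 1 ≤ π.natDegree := Nat.one_le_iff_ne_zero.2 fun h => hirr.not_isUnit (by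
    rw [hπ.natDegree_eq_zero.1 h]
    exact isUnit_one)
  refine mem_of_elementary_symbol_mem (H := H) hfin hres hπ hd1 (fun g hg hcop hgπ => ?_) ξ
  set η : Fin (n + 1) → A[X] := Fin.cons π g with hη
  set Y : MilnorK (RatFunc K) (n + 1) :=
    MilnorSymbol fun j => polyUnit ((η j).map (algebraMap A K)) with hY
  have hYinf : Dinf Y ∈ (map (algebraMap A K)).range := by
    refine tameInf_polyUnit_mem_range hDinf fun i => ⟨η i, ?_, rfl⟩
    refine Fin.cases ?_ (fun k => ?_) i
    · simp [hη, hπ.leadingCoeff]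
    · simpa [hη] using (hg k).1
  have hYπ : D (π.map (algebraMap A K)) Y =
      map (quotMap K π) (MilnorSymbol fun i => residueUnit (hgπ i)) := by
    rw [← tame_cons_eq_map (hirrK hπ hirr) (hD _ (hπ.map _) (hirrK hπ hirr)) hgπ, hY]
    congr 2
    ext k
    refine Fin.cases ?_ (fun k => ?_) k <;> simp [hη]
  have hprime : ∀ i, (g i).natDegree ≠ 0 → (g i).Monic ∧ Irreducible (g i) := fun i hi =>
    (hg i).2.2.resolve_left hi
  have hcorr : ∀ i, ∃ ζ : MilnorK (RatFunc K) (n + 1),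
      ((g i).natDegree ≠ 0 → D ((g i).map (algebraMap A K)) ζ = D ((g i).map (algebraMap A K)) Y) ∧
      (∀ q : K[X], q.Monic → Irreducible q →
        ((g i).natDegree ≠ 0 → q ≠ (g i).map (algebraMap A K)) → D q ζ = 0) ∧
      Dinf ζ ∈ (map (algebraMap A K)).range := by
    intro i
    by_cases hi : (g i).natDegree = 0
    · exact ⟨0, by simp [hi], by simp, by rw [map_zero]; exact zero_mem _⟩
    obtain ⟨hm, hirri⟩ := hprime i hi
    obtain ⟨ξi, hξi⟩ := tame_mem_range (hirrK hm hirri) (hD _ (hm.map _) (hirrK hm hirri))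
      (g := η) i.succ rfl (fun j hj => by
        induction j using Fin.cases with
        | zero => exact (hgπ i).symm
        | succ j => exact hcop j i fun h => hj (h ▸ rfl))
    obtain ⟨ζ, h1, h2, h3⟩ := ih _ (hd ▸ (hg i).2.1) hm hirri ξi rfl
    exact ⟨ζ, fun _ => h1.trans hξi, fun q hq hqi h => h2 q hq hqi (h hi), h3⟩
  choose ζ h1 h2 h3 using hcorr
  refine ⟨Y - ∑ i, ζ i, ?_, fun q hq hqi hqπ => ?_, ?_⟩
  · rw [map_sub, hYπ, map_sum, Finset.sum_eq_zero, sub_zero]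
    refine fun i _ => h2 i _ (hπ.map _) (hirrK hπ hirr) fun _ h => ?_
    have := (hg i).2.1
    rw [← inj h] at this
    exact this.false
  · rw [map_sub, map_sum, sub_eq_zero]
    by_cases hex : ∃ i, (g i).natDegree ≠ 0 ∧ q = (g i).map (algebraMap A K)
    · obtain ⟨i, hi, rfl⟩ := hex
      rw [Finset.sum_eq_single i, h1 i hi]
      · refine fun j _ hji => h2 j _ hq hqi fun _ h => ?_
        have := hcop j i hji
        rw [inj h, isCoprime_self] at this
        exact (hprime j (by rw [← inj h]; exact hi)).2.not_isUnit this
      · simp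
    · push Not at hex
      rw [Finset.sum_eq_zero fun i _ => h2 i q hq hqi fun hi => hex i hi]
      refine tame_eq_zero hqi (hD q hq hqi) _ fun i => ⟨_, ?_, rfl⟩
      induction i using Fin.cases with
      | zero => exact isCoprime_of_ne hq hqi (hπ.map _) (hirrK hπ hirr) hqπ.symm
      | succ i =>
        by_cases hi : (g i).natDegree = 0
        · refine isCoprime_of_degree_lt hqi (ne_zero_of_isCoprime (hirrK hπ hirr)
            (isCoprime_map (hgπ i))) ?_
          exact ((natDegree_map_le (f := algebraMap A K) (p := g i)).trans hi.le).trans_lt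
            hqi.natDegree_pos
        · obtain ⟨hm, hirri⟩ := hprime i hi
          exact isCoprime_of_ne hq hqi (hm.map _) (hirrK hm hirri) (hex i hi).symm
  · rw [map_sub, map_sum]
    exact sub_mem hYinf (sum_mem fun i _ => h3 i)

end Existence

end MilnorK

/-- norm compatibility with image subgroups: let `A` be a semilocal
UFD with infinite residue fields, `F = Q(A)`, `π ∈ A[t]` monic irreducible,
`B = A[t]/(π)` a domain, `L = Q(B)`.  Then the Bass–Tate norm
`N_{L/F} : K^M_n(L) → K^M_n(F)` (computed via `ζ ∈ K^M_{n+1}(F(t))` with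
`∂_{π'} ζ = 0` for `π' ≠ π` and `∂_π ζ = ξ`, as `N(ξ) = -∂_{1/t} ζ`) maps
`im(j_* : K^M_n(B) → K^M_n(L))` into `im(i_* : K^M_n(A) → K^M_n(F))`. -/
theorem norm_image_subgroup (A : Type*) [CommRing A] [IsDomain A]
    [UniqueFactorizationMonoid A]
    (hsemilocal : {I : Ideal A | I.IsMaximal}.Finite)
    (hres : ∀ I : Ideal A, I.IsMaximal → Infinite (A ⧸ I))
    (n : ℕ)
    (π : A[X]) (hπmonic : π.Monic) (hπirr : Irreducible π)
    [IsDomain (A[X] ⧸ Ideal.span {π})]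
    (D : ∀ q : Polynomial (FractionRing A),
      MilnorK (RatFunc (FractionRing A)) (n + 1) →+
        MilnorK (Polynomial (FractionRing A) ⧸ Ideal.span {q}) n)
    (hD : ∀ q : Polynomial (FractionRing A), q.Monic → Irreducible q →
      IsTameSymbol (FractionRing A) n q (D q))
    (Dinf : MilnorK (RatFunc (FractionRing A)) (n + 1) →+ MilnorK (FractionRing A) n)
    (hDinf : IsTameSymbolInf (FractionRing A) n Dinf)
    (iStar : MilnorK A n →+ MilnorK (FractionRing A) n)
    (hi : ∀ (a : Fin n → Aˣ) (u : Fin n → (FractionRing A)ˣ),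
      (∀ i, (u i : FractionRing A) = algebraMap A (FractionRing A) (a i)) →
      iStar (MilnorSymbol a) = MilnorSymbol u)
    (jStar : MilnorK (A[X] ⧸ Ideal.span {π}) n →+
      MilnorK (FractionRing (A[X] ⧸ Ideal.span {π})) n)
    (hj : ∀ (b : Fin n → (A[X] ⧸ Ideal.span {π})ˣ)
        (w : Fin n → (FractionRing (A[X] ⧸ Ideal.span {π}))ˣ),
      (∀ i, (w i : FractionRing (A[X] ⧸ Ideal.span {π})) =
        algebraMap (A[X] ⧸ Ideal.span {π}) (FractionRing (A[X] ⧸ Ideal.span {π}))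
          (b i : A[X] ⧸ Ideal.span {π})) →
      jStar (MilnorSymbol b) = MilnorSymbol w)
    (e : (Polynomial (FractionRing A) ⧸
        Ideal.span {π.map (algebraMap A (FractionRing A))}) ≃+*
      FractionRing (A[X] ⧸ Ideal.span {π}))
    (he : ∀ q : A[X],
      e (Ideal.Quotient.mk (Ideal.span {π.map (algebraMap A (FractionRing A))})
          (q.map (algebraMap A (FractionRing A)))) =
        algebraMap (A[X] ⧸ Ideal.span {π}) (FractionRing (A[X] ⧸ Ideal.span {π}))
          (Ideal.Quotient.mk (Ideal.span {π}) q))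
    (eStar : MilnorK (Polynomial (FractionRing A) ⧸
        Ideal.span {π.map (algebraMap A (FractionRing A))}) n →+
      MilnorK (FractionRing (A[X] ⧸ Ideal.span {π})) n)
    (heStar : ∀ (v : Fin n → (Polynomial (FractionRing A) ⧸
          Ideal.span {π.map (algebraMap A (FractionRing A))})ˣ)
        (w : Fin n → (FractionRing (A[X] ⧸ Ideal.span {π}))ˣ),
      (∀ i, (w i : FractionRing (A[X] ⧸ Ideal.span {π})) = e (v i : _)) →
      eStar (MilnorSymbol v) = MilnorSymbol w)
    (ξB : MilnorK (A[X] ⧸ Ideal.span {π}) n)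
    (ζ : MilnorK (RatFunc (FractionRing A)) (n + 1))
    (hζ : ∀ q : Polynomial (FractionRing A), q.Monic → Irreducible q →
      q ≠ π.map (algebraMap A (FractionRing A)) → D q ζ = 0)
    (hζπ : eStar (D (π.map (algebraMap A (FractionRing A))) ζ) = jStar ξB) :
    -Dinf ζ ∈ Set.range iStar := by
  set F := FractionRing A
  have hi' : iStar = MilnorK.map (algebraMap A F) := MilnorK.hom_ext fun f => by
    rw [MilnorK.map_symbol]
    exact hi _ _ fun i => rfl
  have he' : ∀ ξ, eStar (MilnorK.map (MilnorK.quotMap F π) ξ) = jStar ξ := fun ξ => by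
    suffices eStar.comp (MilnorK.map (MilnorK.quotMap F π)) = jStar from
      DFunLike.congr_fun this ξ
    refine MilnorK.hom_ext fun f => ?_
    rw [AddMonoidHom.comp_apply, MilnorK.map_symbol,
      hj f (fun i => Units.map (algebraMap _ _).toMonoidHom (f i)) fun i => rfl]
    refine heStar _ _ fun i => ?_
    obtain ⟨q, hq⟩ := Ideal.Quotient.mk_surjective (f i : A[X] ⧸ Ideal.span {π})
    simp only [Units.coe_map, RingHom.toMonoidHom_eq_coe, MonoidHom.coe_coe, ← hq,
      MilnorK.quotMap_mk]
    exact (he q).symm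
  have heinj : Function.Injective eStar := by
    refine Function.LeftInverse.injective
      (g := MilnorK.map (e.symm : FractionRing (A[X] ⧸ Ideal.span {π}) →+* _)) fun x => ?_
    refine DFunLike.congr_fun (f := (MilnorK.map _).comp eStar) (g := AddMonoidHom.id _)
      (MilnorK.hom_ext fun f => ?_) x
    rw [AddMonoidHom.comp_apply, heStar f (fun i => Units.map e.toRingHom.toMonoidHom (f i))
      fun i => rfl, MilnorK.map_symbol]
    refine congrArg MilnorSymbol (funext fun i => Units.ext ?_)
    exact e.symm_apply_apply _
  obtain ⟨ζ', h1, h2, h3⟩ :=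
    MilnorK.exists_tame_eq hsemilocal hres hD hDinf hπmonic hπirr ξB
  have hζ' : Dinf (ζ - ζ') = 0 := by
    refine MilnorK.tameInf_eq_zero hD hDinf fun q hq hqi => ?_
    rw [map_sub, sub_eq_zero]
    by_cases h : q = π.map (algebraMap A F)
    · subst h
      exact heinj (by rw [hζπ, h1, he'])
    · rw [hζ q hq hqi h, h2 q hq hqi h]
  rw [map_sub, sub_eq_zero] at hζ'
  rw [hζ', hi']
  exact neg_mem h3
end
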